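/- Let q be a power of 2, n ≥ 1, V a non-degenerate quadratic space of dimension 2n+1 over 𝐅_q, and T a nilpotent element of 𝔬(V). Let (λ_i, χ_i, m_i)_{1≤i≤k} be the symbol of the scalar extension (V ⊗_{𝐅_q} 𝐅̄_q, T), and set n₁ = #{1 ≤ i ≤ k−1 : χ_i + χ_{i+1} ≤ λ_i and χ_i ≠ λ_i/2}. Then the set of nilpotent T′ ∈ 𝔬(V) whose scalar extension (V ⊗_{𝐅_q} 𝐅̄_q, T′) is isomorphic to (V ⊗_{𝐅_q} 𝐅̄_q, T) as a form module is the union of exactly 2^{n₁} orbits of O(V) acting by conjugation. -/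

import Mathlib

open Module Finset

/-- The radical `V^⊥ = {v | ⟨v,w⟩ = 0 for all w}` of the polar form of `Q`. -/
def QuadraticForm.polarRadical {F V : Type*} [Field F] [AddCommGroup V] [Module F V]
    (Q : QuadraticForm F V) : Submodule F V :=
  LinearMap.ker (QuadraticMap.polarBilin Q)

/-- A quadratic space `(V, Q)` (in characteristic 2) is non-degenerate if `V ≠ 0`,
`dim V^⊥ ≤ 1` and `Q(v) ≠ 0` for every nonzero `v ∈ V^⊥`. -/
def QuadraticForm.IsNondegenerateFormSpace {F V : Type*} [Field F] [AddCommGroup V] [Module F V]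
    (Q : QuadraticForm F V) : Prop :=
  Nontrivial V ∧ Module.finrank F Q.polarRadical ≤ 1 ∧
    ∀ v ∈ Q.polarRadical, v ≠ 0 → Q v ≠ 0

/-- Membership in the orthogonal Lie algebra
`𝔬(V) = {x ∈ End(V) | ⟨xv, v⟩ = 0 ∀ v, tr x = 0}`. -/
def QuadraticForm.mem_oLie {F V : Type*} [Field F] [AddCommGroup V] [Module F V]
    (Q : QuadraticForm F V) (x : Module.End F V) : Prop :=
  (∀ v : V, QuadraticMap.polar Q (x v) v = 0) ∧ LinearMap.trace F V x = 0

/-- Two endomorphisms of `V` are conjugate under the orthogonal group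
`O(V) = {g ∈ GL(V) | Q(gv) = Q(v) ∀ v}`. -/
def QuadraticForm.OConj {F V : Type*} [Field F] [AddCommGroup V] [Module F V]
    (Q : QuadraticForm F V) (x y : Module.End F V) : Prop :=
  ∃ g : V ≃ₗ[F] V, (∀ v : V, Q (g v) = Q v) ∧
    y = g.toLinearMap ∘ₗ x ∘ₗ g.symm.toLinearMap

/-- The number of orbits of `O(V)` acting by conjugation on the set of nilpotent
elements of `𝔬(V)`. -/
noncomputable def QuadraticForm.numNilpotentOOrbits {F V : Type*} [Field F] [AddCommGroup V]
    [Module F V] (Q : QuadraticForm F V) : ℕ :=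
  Nat.card (Quot fun x y : {x : Module.End F V // Q.mem_oLie x ∧ IsNilpotent x} =>
    Q.OConj x.1 y.1)


/-- `(V, Q)` contains a totally singular subspace of dimension `d`
(so the Witt index of `Q` is at least `d`). -/
def QuadraticForm.HasTotallySingularSubspace {F V : Type*} [Field F] [AddCommGroup V]
    [Module F V] (Q : QuadraticForm F V) (d : ℕ) : Prop :=
  ∃ W : Submodule F V, Module.finrank F W = d ∧ ∀ w ∈ W, Q w = 0

/-- `(V₁, Q₁, T₁)` over `K` is (isomorphic to) the scalar extension of the form module
`(V₀, Q₀, T₀)` over `F ⊆ K`: there is an additive, `algebraMap`-semilinear map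
`σ : V₀ → V₁` carrying `Q₀` to `Q₁` and intertwining `T₀` with `T₁`, which carries some
`F`-basis of `V₀` to a `K`-basis of `V₁`.  (The extended quadratic form is determined by
its values and the values of its polar form on such a basis.) -/
def QuadraticForm.IsScalarExtension {F K V₀ V₁ : Type*} [Field F] [Field K] [Algebra F K]
    [AddCommGroup V₀] [Module F V₀] [AddCommGroup V₁] [Module K V₁]
    (Q₀ : QuadraticForm F V₀) (T₀ : Module.End F V₀)
    (Q₁ : QuadraticForm K V₁) (T₁ : Module.End K V₁) : Prop :=
  ∃ σ : V₀ →ₛₗ[algebraMap F K] V₁,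
    (∀ v : V₀, Q₁ (σ v) = algebraMap F K (Q₀ v)) ∧
    (∀ v : V₀, σ (T₀ v) = T₁ (σ v)) ∧
    ∃ (n : ℕ) (b : Basis (Fin n) F V₀),
      LinearIndependent K (fun i => σ (b i)) ∧
      Submodule.span K (Set.range fun i => σ (b i)) = ⊤

/-- The index function `χ(V,T) : ℕ → ℕ`,
`χ(m) = min {j ≥ 0 | Q(T^j v) = 0 for all v with T^m v = 0}`. -/
noncomputable def QuadraticForm.indexChi {F V : Type*} [Field F] [AddCommGroup V] [Module F V]
    (Q : QuadraticForm F V) (T : Module.End F V) (m : ℕ) : ℕ :=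
  sInf {j : ℕ | ∀ v : V, (T ^ m) v = 0 → Q ((T ^ j) v) = 0}

/-- `(lam i, chi i, mult i)` for `i < k` is the symbol of the form module `(V, Q, T)`:
`lam 0 > lam 1 > ⋯ > lam (k-1) ≥ 1` are the distinct Jordan block sizes of `T` (encoded by
`dim ker T^j = Σ_i (mult i) · min(j, lam i)` for all `j`), `mult i ≥ 1` are their
multiplicities, and `chi i = χ(V,T)(lam i)`. -/
def QuadraticForm.IsSymbolOf {F V : Type*} [Field F] [AddCommGroup V] [Module F V]
    (Q : QuadraticForm F V) (T : Module.End F V) (k : ℕ) (lam mult chi : ℕ → ℕ) : Prop :=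
  (∀ i : ℕ, i + 1 < k → lam (i + 1) < lam i) ∧
  (∀ i < k, 1 ≤ lam i) ∧
  (∀ i < k, 1 ≤ mult i) ∧
  (∀ j : ℕ, Module.finrank F (LinearMap.ker (T ^ j)) =
      ∑ i ∈ Finset.range k, mult i * min j (lam i)) ∧
  (∀ i < k, chi i = Q.indexChi T (lam i))

/-- `n₁ = #{1 ≤ i ≤ k-1 | χ_i + χ_{i+1} ≤ λ_i, χ_i ≠ λ_i/2}` (in 0-indexed form). -/
def symbolN1 (k : ℕ) (lam chi : ℕ → ℕ) : ℕ :=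
  ((Finset.range k).filter fun i =>
    i + 1 < k ∧ chi i + chi (i + 1) ≤ lam i ∧ 2 * chi i ≠ lam i).card

/-- `n₂ = #{1 ≤ i ≤ k | χ_i + χ_{i+1} ≤ λ_i, χ_i ≠ λ_i/2}` where `χ_{k+1} := 0`
(in 0-indexed form: `χ_k := 0`). -/
def symbolN2 (k : ℕ) (lam chi : ℕ → ℕ) : ℕ :=
  ((Finset.range k).filter fun i =>
    chi i + (if i + 1 < k then chi (i + 1) else 0) ≤ lam i ∧ 2 * chi i ≠ lam i).card

set_option linter.unusedSectionVars false

/-- Abstract structure on the quotient by the radical. -/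
structure FS (F W : Type*) [Field F] [AddCommGroup W] [Module F W] where
  B : W →ₗ[F] W →ₗ[F] F
  T : Module.End F W
  ka : W → F
  alt : ∀ w, B w w = 0
  nd : ∀ w, (∀ u, B w u = 0) → w = 0
  altT : ∀ w, B (T w) w = 0
  nil : IsNilpotent T
  ka_smul : ∀ (c : F) w, ka (c • w) = c ^ 2 * ka w
  ka_add : ∀ v w, ka (v + w) = ka v + ka w + B (T (T v)) w

namespace FS

variable {F W : Type*} [Field F] [CharP F 2] [AddCommGroup W] [Module F W]

theorem add_self_F (a : F) : a + a = 0 := CharTwo.add_self_eq_zero a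

theorem eq_of_add_F {a b : F} (h : a + b = 0) : a = b := CharTwo.add_eq_zero.mp h

theorem pw {W : Type*} [AddCommGroup W] [Module F W] (T : Module.End F W) (p q : ℕ) (w : W) :
    (T ^ p) ((T ^ q) w) = (T ^ (p + q)) w := by
  rw [pow_add]; rfl

variable (D : FS F W)

theorem symm (v w : W) : D.B v w = D.B w v := by
  have h := D.alt (v + w)
  simp only [map_add, LinearMap.add_apply, D.alt] at h
  apply eq_of_add_F
  linear_combination h

theorem adj (v w : W) : D.B (D.T v) w = D.B v (D.T w) := by
  have h := D.altT (v + w)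
  simp only [map_add, LinearMap.add_apply, D.altT] at h
  rw [D.symm v]
  apply eq_of_add_F
  linear_combination h

theorem adj_pow (p : ℕ) (v w : W) : D.B ((D.T ^ p) v) w = D.B v ((D.T ^ p) w) := by
  induction p generalizing v w with
  | zero => rfl
  | succ p ih =>
    rw [pow_succ, Module.End.mul_apply, ih, D.adj, ← Module.End.mul_apply, ← pow_succ', pow_succ]

theorem adj2 (p q : ℕ) (v w : W) :
    D.B ((D.T ^ p) v) ((D.T ^ q) w) = D.B ((D.T ^ (p + q)) v) w := by
  rw [add_comm, ← pw, D.adj_pow q]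

theorem alt_pow (p : ℕ) (v : W) : D.B ((D.T ^ p) v) v = 0 := by
  obtain ⟨k, rfl | rfl⟩ := p.even_or_odd'
  · rw [two_mul, ← D.adj2, D.alt]
  · have : 2 * k + 1 = (k + 1) + k := by ring
    rw [this, ← D.adj2, add_comm, ← pw, pow_one, D.altT]

theorem alt_pow2 (p q : ℕ) (v : W) : D.B ((D.T ^ p) v) ((D.T ^ q) v) = 0 := by
  rw [adj2, alt_pow]

theorem ka_zero : D.ka 0 = 0 := by
  have := D.ka_smul 0 0
  simpa using this

theorem ka_pow_add (j : ℕ) (v w : W) :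
    D.ka ((D.T ^ j) (v + w)) =
      D.ka ((D.T ^ j) v) + D.ka ((D.T ^ j) w) + D.B ((D.T ^ (2 * j + 2)) v) w := by
  rw [map_add, D.ka_add]
  congr 1
  have : D.T (D.T ((D.T ^ j) v)) = (D.T ^ (j + 2)) v := by
    rw [add_comm, ← pw]; simp [pow_two]
  rw [this, adj2]
  have h2 : j + 2 + j = 2 * j + 2 := by omega
  rw [h2]

theorem ka_pow_smul (j : ℕ) (c : F) (w : W) :
    D.ka ((D.T ^ j) (c • w)) = c ^ 2 * D.ka ((D.T ^ j) w) := by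
  rw [map_smul, D.ka_smul]

theorem pow_zero_of_le {p q : ℕ} (h : p ≤ q) {w : W} (hw : (D.T ^ p) w = 0) :
    (D.T ^ q) w = 0 := by
  obtain ⟨k, rfl⟩ := Nat.exists_eq_add_of_le' h
  rw [← pw, hw, map_zero]

/-! The index function. -/

def H (m j : ℕ) : Prop := ∀ w, (D.T ^ m) w = 0 → D.ka ((D.T ^ j) w) = 0

noncomputable def h (m : ℕ) : ℕ := sInf {j | D.H m j}

theorem H_self (m : ℕ) : D.H m m := fun w hw => by rw [hw, D.ka_zero]

theorem H_h (m : ℕ) : D.H m (D.h m) := Nat.sInf_mem (s := {j | D.H m j}) ⟨m, D.H_self m⟩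

theorem H_mono {m j j' : ℕ} (hj : j ≤ j') (hH : D.H m j) : D.H m j' := by
  intro w hw
  obtain ⟨k, rfl⟩ := Nat.exists_eq_add_of_le hj
  rw [← pw]
  apply hH
  rw [pw, add_comm, ← pw, hw, map_zero]

theorem h_le_iff {m j : ℕ} : D.h m ≤ j ↔ D.H m j :=
  ⟨fun h => D.H_mono h (D.H_h m), fun h => Nat.sInf_le h⟩

theorem h_le_self (m : ℕ) : D.h m ≤ m := D.h_le_iff.2 (D.H_self m)

theorem ka_eq_zero {m j : ℕ} (hj : D.h m ≤ j) {w : W} (hw : (D.T ^ m) w = 0) :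
    D.ka ((D.T ^ j) w) = 0 := D.h_le_iff.1 hj w hw

theorem h_mono {m m' : ℕ} (hm : m ≤ m') : D.h m ≤ D.h m' :=
  D.h_le_iff.2 fun w hw => D.H_h m' w (D.pow_zero_of_le hm hw)

theorem h_lip {m m' : ℕ} (hm : m ≤ m') : D.h m' ≤ D.h m + (m' - m) := by
  refine D.h_le_iff.2 fun w hw => ?_
  rw [← pw]
  apply D.H_h m
  rw [pw]
  convert hw using 3
  omega

/-! Frames. -/

structure PF {r : ℕ} (lam : Fin r → ℕ) (x : Fin r × Bool → W) : Prop where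
  pos : ∀ i, 1 ≤ lam i
  kill : ∀ a, (D.T ^ (lam a.1)) (x a) = 0
  pair : ∀ p a b, D.B ((D.T ^ p) (x a)) (x b) =
    if a.1 = b.1 ∧ a.2 ≠ b.2 ∧ p + 1 = lam a.1 then 1 else 0

theorem linInd_of_pair {ι : Type*} [Finite ι] (B : W →ₗ[F] W →ₗ[F] F) (X Y : ι → W)
    (h : ∀ i j, B (X i) (Y j) = Set.indicator {j} (fun _ => (1 : F)) i) :
    LinearIndependent F X := by
  classical
  have := Fintype.ofFinite ι
  rw [Fintype.linearIndependent_iff]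
  intro g hg i
  have := congrArg (fun v => B v (Y i)) hg
  simp only [map_sum, LinearMap.sum_apply, map_smul, LinearMap.smul_apply, h, map_zero,
    LinearMap.zero_apply, Set.indicator_apply, Set.mem_singleton_iff, smul_eq_mul, mul_ite,
    mul_one, mul_zero] at this
  simpa using this

variable {D}

namespace PF
variable {r : ℕ} {lam : Fin r → ℕ} {x : Fin r × Bool → W} (P : D.PF lam x)

/-- index set of the basis -/
abbrev Ix (lam : Fin r → ℕ) := Σ a : Fin r × Bool, Fin (lam a.1)

variable (D x) in
/-- vectors of the basis -/
def X (u : Ix lam) : W := (D.T ^ (u.2 : ℕ)) (x u.1)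

variable (D x) in
/-- dual vectors -/
def Y (u : Ix lam) : W := (D.T ^ (lam u.1.1 - 1 - (u.2 : ℕ))) (x (u.1.1, !u.1.2))

theorem card_Ix (lam : Fin r → ℕ) : Fintype.card (Ix lam) = ∑ i, 2 * lam i := by
  simp [Fintype.card_sigma, Fintype.sum_prod_type, two_mul]

include P

theorem pair2 (p q : ℕ) (a b : Fin r × Bool) :
    D.B ((D.T ^ p) (x a)) ((D.T ^ q) (x b)) =
    if a.1 = b.1 ∧ a.2 ≠ b.2 ∧ p + q + 1 = lam a.1 then 1 else 0 := by
  rw [D.adj2, P.pair]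

theorem kill_le {p : ℕ} {a : Fin r × Bool} (h : lam a.1 ≤ p) : (D.T ^ p) (x a) = 0 :=
  D.pow_zero_of_le h (P.kill a)

theorem XY (u v : Ix lam) : D.B (X D x u) (Y D x v) =
    Set.indicator {v} (fun _ => (1 : F)) u := by
  classical
  obtain ⟨⟨i, s⟩, p, hp⟩ := u
  obtain ⟨⟨j, t⟩, q, hq⟩ := v
  simp only [X, Y, P.pair2, Set.indicator_apply, Set.mem_singleton_iff]
  congr 1
  simp only [Sigma.mk.injEq, Prod.mk.injEq, eq_iff_iff]
  constructor
  · rintro ⟨h1, h2, h3⟩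
    subst h1
    simp only at hp hq
    have : s = t := by revert h2; cases s <;> cases t <;> simp
    subst this
    have : p = q := by omega
    subst this
    simp
  · rintro ⟨⟨rfl, rfl⟩, h⟩
    have h := eq_of_heq h
    simp only [Fin.mk.injEq] at h
    subst h
    simp only at hp
    refine ⟨rfl, by cases s <;> simp, by omega⟩

theorem linInd : LinearIndependent F (fun u : Ix lam => X D x u) :=
  linInd_of_pair D.B _ _ (P.XY)

theorem card_le [FiniteDimensional F W] : ∑ i, 2 * lam i ≤ finrank F W := by
  rw [← card_Ix lam]
  exact P.linInd.fintype_card_le_finrank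

/-- orthogonal projection -/
theorem proj (w : W) : ∃ u ∈ Submodule.span F (Set.range (fun u : Ix lam => X D x u)),
    ∀ q b, D.B (w - u) ((D.T ^ q) (x b)) = 0 := by
  classical
  refine ⟨∑ v : Ix lam, D.B w (Y D x v) • X D x v, ?_, ?_⟩
  · exact Submodule.sum_mem _ fun v _ => Submodule.smul_mem _ _ (Submodule.subset_span ⟨v, rfl⟩)
  · have key : ∀ v0 : Ix lam, D.B (w - ∑ v : Ix lam, D.B w (Y D x v) • X D x v) (Y D x v0) = 0 := by
      intro v0
      simp only [map_sub, LinearMap.sub_apply, map_sum, LinearMap.sum_apply, map_smul,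
        LinearMap.smul_apply, P.XY, Set.indicator_apply, Set.mem_singleton_iff, smul_eq_mul,
        mul_ite, mul_one, mul_zero]
      simp
    intro q b
    by_cases hq : lam b.1 ≤ q
    · rw [P.kill_le hq, map_zero]
    · have := key ⟨(b.1, !b.2), ⟨lam b.1 - 1 - q, by simp only; omega⟩⟩
      simp only [Y, Bool.not_not] at this
      have e : lam b.1 - 1 - (lam b.1 - 1 - q) = q := by omega
      rwa [e] at this

theorem snoc {n : ℕ} (hn : 1 ≤ n) {e f : W} (he : ∀ q b, D.B e ((D.T ^ q) (x b)) = 0)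
    (hf : ∀ q b, D.B f ((D.T ^ q) (x b)) = 0) (hen : (D.T ^ n) e = 0) (hfn : (D.T ^ n) f = 0)
    (hef : ∀ p, D.B ((D.T ^ p) e) f = if p + 1 = n then 1 else 0) :
    D.PF (Fin.cons n lam : Fin (r + 1) → ℕ)
      (fun a => (Fin.cons (if a.2 then e else f) (fun i => x (i, a.2)) : Fin (r + 1) → W) a.1) := by
  have hfe : ∀ p, D.B ((D.T ^ p) f) e = if p + 1 = n then 1 else 0 := by
    intro p; rw [D.adj_pow, D.symm, hef]
  have he2 : ∀ p b, D.B ((D.T ^ p) e) (x b) = 0 := fun p b => by rw [D.adj_pow, he]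
  have hf2 : ∀ p b, D.B ((D.T ^ p) f) (x b) = 0 := fun p b => by rw [D.adj_pow, hf]
  have he3 : ∀ p b, D.B ((D.T ^ p) (x b)) e = 0 := fun p b => by rw [D.symm, he]
  have hf3 : ∀ p b, D.B ((D.T ^ p) (x b)) f = 0 := fun p b => by rw [D.symm, hf]
  constructor
  · intro i
    refine Fin.cases ?_ (fun i => ?_) i
    · simpa using hn
    · simpa using P.pos i
  · rintro ⟨i, s⟩
    refine Fin.cases ?_ (fun i => ?_) i
    · cases s <;> simp [hen, hfn]
    · simpa using P.kill (i, s)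
  · rintro p ⟨i, s⟩ ⟨j, t⟩
    refine Fin.cases ?_ (fun i => ?_) i <;> refine Fin.cases ?_ (fun j => ?_) j
    · cases s <;> cases t <;> simp [hef, hfe, D.alt_pow]
    · cases s <;> simp [he2, hf2, (Fin.succ_ne_zero j).symm]
    · cases t <;> simp [he3, hf3]
    · simpa using P.pair p (i, s) (j, t)

theorem extend [FiniteDimensional F W] (hlt : ∑ i, 2 * lam i ≠ finrank F W) :
    ∃ (n : ℕ) (y : Fin (r + 1) × Bool → W), D.PF (Fin.cons n lam : Fin (r + 1) → ℕ) y := by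
  classical
  let O : Submodule F W :=
    { carrier := {w | ∀ q b, D.B w ((D.T ^ q) (x b)) = 0}
      add_mem' := by
        intro a b ha hb q c
        rw [map_add, LinearMap.add_apply, ha, hb, add_zero]
      zero_mem' := by intro q c; simp
      smul_mem' := by
        intro c a ha q b
        rw [map_smul, LinearMap.smul_apply, ha, smul_zero] }
  have hOT : ∀ p w, w ∈ O → (D.T ^ p) w ∈ O := by
    intro p w hw q b
    rw [D.adj_pow, pw]; exact hw _ _
  have hOspan : ∀ w ∈ O, ∀ u ∈ Submodule.span F (Set.range (fun u : Ix lam => X D x u)),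
      D.B w u = 0 := by
    intro w hw u hu
    induction hu using Submodule.span_induction with
    | mem u hu => obtain ⟨v, rfl⟩ := hu; exact hw _ _
    | zero => simp
    | add a b _ _ ha hb => rw [map_add, ha, hb, add_zero]
    | smul c a _ ha => rw [map_smul, ha, smul_zero]
  have hO : ∃ w ∈ O, w ≠ 0 := by
    by_contra hcon
    push Not at hcon
    apply hlt
    rw [← card_Ix lam]
    have htop : Submodule.span F (Set.range (fun u : Ix lam => X D x u)) = ⊤ := by
      rw [eq_top_iff]
      intro w _
      obtain ⟨u, hu, hw⟩ := P.proj w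
      have := hcon (w - u) hw
      rw [sub_eq_zero] at this
      rwa [this]
    have := finrank_span_eq_card P.linInd
    rw [htop, finrank_top] at this
    exact this.symm
  obtain ⟨w0, hw0, hw0n⟩ := hO
  have hex : ∃ n, ∀ w ∈ O, (D.T ^ n) w = 0 := by
    obtain ⟨n, hn⟩ := D.nil
    exact ⟨n, fun w _ => by rw [hn]; rfl⟩
  obtain ⟨n, hn1, hnmin⟩ : ∃ n, (∀ w ∈ O, (D.T ^ n) w = 0) ∧
      ∀ m, m < n → ¬ ∀ w ∈ O, (D.T ^ m) w = 0 :=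
    ⟨Nat.find hex, Nat.find_spec hex, fun m hm => Nat.find_min hex hm⟩
  have hpos : 1 ≤ n := by
    rcases Nat.eq_zero_or_pos n with h0 | h0
    · rw [h0] at hn1; exact absurd (hn1 w0 hw0) hw0n
    · exact h0
  have hn2 : ¬ ∀ w ∈ O, (D.T ^ (n - 1)) w = 0 := hnmin _ (by omega)
  push Not at hn2
  obtain ⟨e, heO, he⟩ := hn2
  have : ∃ f, D.B ((D.T ^ (n - 1)) e) f ≠ 0 := by
    by_contra hcon
    push Not at hcon
    exact he (D.nd _ hcon)
  obtain ⟨f0, hf0⟩ := this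
  obtain ⟨u, hu, hfu⟩ := P.proj f0
  have hf1 : D.B ((D.T ^ (n - 1)) e) (f0 - u) ≠ 0 := by
    rw [map_sub, hOspan _ (hOT _ _ heO) u hu, sub_zero]; exact hf0
  have hmain : ∀ k, ∃ f ∈ O, D.B ((D.T ^ (n - 1)) e) f = 1 ∧
      ∀ p, p + 1 < n → n ≤ p + 1 + k → D.B ((D.T ^ p) e) f = 0 := by
    intro k
    induction k with
    | zero =>
      refine ⟨(D.B ((D.T ^ (n - 1)) e) (f0 - u))⁻¹ • (f0 - u), O.smul_mem _ hfu, ?_, ?_⟩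
      · rw [map_smul, smul_eq_mul, inv_mul_cancel₀ hf1]
      · intro p h1 h2; omega
    | succ k ih =>
      obtain ⟨f, hfO, hf, hfp⟩ := ih
      by_cases hk : k + 2 ≤ n
      · refine ⟨f + D.B ((D.T ^ (n - 2 - k)) e) f • (D.T ^ (k + 1)) f,
          O.add_mem hfO (O.smul_mem _ (hOT _ _ hfO)), ?_, ?_⟩
        · rw [map_add, map_smul, D.adj2, hf]
          have hz : (D.T ^ (n - 1 + (k + 1))) e = 0 :=
            D.pow_zero_of_le (p := n) (by omega) (hn1 e heO)
          rw [hz]; simp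
        · intro p h1 h2
          rw [map_add, map_smul, D.adj2]
          by_cases h3 : n ≤ p + 1 + k
          · have hz : (D.T ^ (p + (k + 1))) e = 0 :=
              D.pow_zero_of_le (p := n) (by omega) (hn1 e heO)
            rw [hfp p h1 h3, hz]; simp
          · have h4 : p = n - 2 - k := by omega
            have h5 : p + (k + 1) = n - 1 := by omega
            rw [h5, hf, ← h4, smul_eq_mul, mul_one]
            exact add_self_F _
      · exact ⟨f, hfO, hf, fun p h1 h2 => hfp p h1 (by omega)⟩
  obtain ⟨f, hfO, hf, hfp⟩ := hmain n
  refine ⟨n, _, P.snoc hpos heO hfO (hn1 e heO) (hn1 f hfO) ?_⟩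
  intro p
  split_ifs with h
  · have : p = n - 1 := by omega
    rw [this, hf]
  · by_cases h2 : p + 1 < n
    · exact hfp p h2 (by omega)
    · rw [D.pow_zero_of_le (p := n) (by omega) (hn1 e heO)]; simp

end PF

variable (D) in
structure Fr {r : ℕ} (lam : Fin r → ℕ) (x : Fin r × Bool → W) : Prop extends D.PF lam x where
  dim : finrank F W = ∑ i, 2 * lam i

theorem PF.reindex {r : ℕ} {lam : Fin r → ℕ} {x : Fin r × Bool → W} (P : D.PF lam x)
    (σ : Equiv.Perm (Fin r)) : D.PF (lam ∘ σ) (fun a => x (σ a.1, a.2)) :=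
  ⟨fun i => P.pos _, fun a => P.kill (σ a.1, a.2), fun p a b => by
    rw [P.pair]; simp⟩

variable (D) in
theorem exists_frame [FiniteDimensional F W] :
    ∃ (r : ℕ) (lam : Fin r → ℕ) (x : Fin r × Bool → W), D.Fr lam x ∧ Antitone lam := by
  have h1 : ∀ d, ∀ (r : ℕ) (lam : Fin r → ℕ) (x : Fin r × Bool → W), D.PF lam x →
      finrank F W - ∑ i, 2 * lam i = d →
      ∃ (r : ℕ) (lam : Fin r → ℕ) (x : Fin r × Bool → W), D.Fr lam x := by
    intro d
    induction d using Nat.strong_induction_on with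
    | _ d ih =>
      intro r lam x P hd
      by_cases hlt : ∑ i, 2 * lam i = finrank F W
      · exact ⟨r, lam, x, P, hlt.symm⟩
      · obtain ⟨n, y, Py⟩ := P.extend hlt
        have h1 := P.card_le
        have h2 := Py.card_le
        have h3 := Py.pos 0
        rw [Fin.sum_univ_succ] at h2
        simp only [Fin.cons_zero, Fin.cons_succ] at h2 h3
        refine ih _ ?_ _ _ _ Py rfl
        rw [Fin.sum_univ_succ]
        simp only [Fin.cons_zero, Fin.cons_succ]
        omega
  obtain ⟨r, lam, x, P⟩ := h1 _ 0 Fin.elim0 (fun a => a.1.elim0)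
    ⟨fun i => i.elim0, fun a => a.1.elim0, fun _ a => a.1.elim0⟩ rfl
  let σ := Tuple.sort (fun i => OrderDual.toDual (lam i))
  refine ⟨r, lam ∘ σ, _, ⟨P.toPF.reindex σ, ?_⟩, ?_⟩
  · rw [P.dim]
    exact (Equiv.sum_comp σ (fun i => 2 * lam i)).symm
  · have := Tuple.monotone_sort (fun i => OrderDual.toDual (lam i))
    intro i j hij
    exact this hij

end FS

namespace FS

variable {F W : Type*} [Field F] [CharP F 2] [AddCommGroup W] [Module F W]
variable {D : FS F W} {r : ℕ} {lam : Fin r → ℕ} {x : Fin r × Bool → W}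

theorem PF.ka_move (P : D.PF lam x) (p k : ℕ) (c : F) (a b : Fin r × Bool) :
    D.ka ((D.T ^ p) (x a + c • (D.T ^ k) (x b))) =
      D.ka ((D.T ^ p) (x a)) + c ^ 2 * D.ka ((D.T ^ (p + k)) (x b)) +
      c * (if a.1 = b.1 ∧ a.2 ≠ b.2 ∧ 2 * p + 2 + k + 1 = lam a.1 then 1 else 0) := by
  rw [D.ka_pow_add, D.ka_pow_smul, pw, map_smul, P.pair2, smul_eq_mul]

theorem bool_ne_iff {s t : Bool} : s ≠ t ↔ t = !s := by cases s <;> cases t <;> simp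

/-- Move 1. -/
theorem PF.move1 (P : D.PF lam x) (i : Fin r) (s : Bool) (c : F) (k : ℕ) :
    D.PF lam (Function.update x (i, !s) (x (i, !s) + c • (D.T ^ k) (x (i, s)))) := by
  classical
  have hk : (D.T ^ lam i) ((D.T ^ k) (x (i, s))) = 0 := by
    rw [pw, P.kill_le]; simp
  refine ⟨P.pos, fun a => ?_, fun p a b => ?_⟩
  · by_cases ha : a = (i, !s)
    · subst ha
      rw [Function.update_self, map_add, P.kill (i, !s), map_smul]
      simp only [hk, smul_zero, add_zero]
    · rw [Function.update_of_ne ha, P.kill]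
  · by_cases ha : a = (i, !s)
    · by_cases hb : b = (i, !s)
      · rw [ha, hb, D.alt_pow]; simp
      · subst ha
        rw [Function.update_self, Function.update_of_ne hb, map_add, map_smul, pw, map_add,
          LinearMap.add_apply, map_smul, LinearMap.smul_apply, P.pair, P.pair]
        have : ¬ ((i, s).1 = b.1 ∧ (i, s).2 ≠ b.2 ∧ p + k + 1 = lam (i, s).1) := by
          rintro ⟨h1, h2, -⟩
          apply hb
          rw [bool_ne_iff] at h2
          ext <;> simp_all
        rw [if_neg this, smul_zero, add_zero]
    · by_cases hb : b = (i, !s)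
      · subst hb
        rw [Function.update_self, Function.update_of_ne ha, map_add, map_smul, P.pair, P.pair2]
        have : ¬ (a.1 = (i, s).1 ∧ a.2 ≠ (i, s).2 ∧ p + k + 1 = lam a.1) := by
          rintro ⟨h1, h2, -⟩
          apply ha
          rw [ne_comm, bool_ne_iff] at h2
          ext <;> simp_all
        rw [if_neg this, smul_zero, add_zero]
      · rw [Function.update_of_ne hb, Function.update_of_ne ha, P.pair]

/-- Move 4. -/
theorem PF.move4 (P : D.PF lam x) (i j : Fin r) (hij : i ≠ j) (s t : Bool) (c : F) (k l : ℕ)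
    (hkl : k + lam i = l + lam j) :
    D.PF lam (Function.update (Function.update x (i, !s) (x (i, !s) + c • (D.T ^ k) (x (j, t))))
      (j, !t) (x (j, !t) + c • (D.T ^ l) (x (i, s)))) := by
  classical
  have hk : (D.T ^ lam i) ((D.T ^ k) (x (j, t))) = 0 := by
    rw [pw, P.kill_le]; simp; omega
  have hl : (D.T ^ lam j) ((D.T ^ l) (x (i, s))) = 0 := by
    rw [pw, P.kill_le]; simp; omega
  set y := Function.update (Function.update x (i, !s) (x (i, !s) + c • (D.T ^ k) (x (j, t))))
      (j, !t) (x (j, !t) + c • (D.T ^ l) (x (i, s))) with hy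
  have hne : ((i, !s) : Fin r × Bool) ≠ (j, !t) := by
    intro h; exact hij (congrArg Prod.fst h)
  have y1 : y (i, !s) = x (i, !s) + c • (D.T ^ k) (x (j, t)) := by
    rw [hy, Function.update_of_ne hne, Function.update_self]
  have y2 : y (j, !t) = x (j, !t) + c • (D.T ^ l) (x (i, s)) := by
    rw [hy, Function.update_self]
  have y3 : ∀ a, a ≠ (i, !s) → a ≠ (j, !t) → y a = x a := by
    intro a h1 h2
    rw [hy, Function.update_of_ne h2, Function.update_of_ne h1]
  have key1 : ∀ p b, b ≠ (j, !t) → D.B ((D.T ^ p) (x (j, t))) (x b) = 0 := by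
    intro p b hb
    rw [P.pair, if_neg]
    rintro ⟨h1, h2, -⟩
    apply hb
    rw [bool_ne_iff] at h2
    ext <;> simp_all
  have key2 : ∀ p b, b ≠ (i, !s) → D.B ((D.T ^ p) (x (i, s))) (x b) = 0 := by
    intro p b hb
    rw [P.pair, if_neg]
    rintro ⟨h1, h2, -⟩
    apply hb
    rw [bool_ne_iff] at h2
    ext <;> simp_all
  have key3 : ∀ p q, D.B ((D.T ^ p) (x (i, s))) ((D.T ^ q) (x (j, t))) = 0 := by
    intro p q
    rw [P.pair2, if_neg]
    rintro ⟨h1, -⟩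
    exact hij h1
  have key4 : ∀ p q, D.B ((D.T ^ p) (x (j, t))) ((D.T ^ q) (x (i, s))) = 0 := by
    intro p q
    rw [P.pair2, if_neg]
    rintro ⟨h1, -⟩
    exact hij h1.symm
  -- it is enough to check in one order
  have main : ∀ p a b, (a = (j, !t) → b = (j, !t)) ∧ (a = (i, !s) → b = (i, !s) ∨ b = (j, !t)) →
      D.B ((D.T ^ p) (y a)) (y b) =
      if a.1 = b.1 ∧ a.2 ≠ b.2 ∧ p + 1 = lam a.1 then 1 else 0 := by
    intro p a b hab
    by_cases ha : a = (j, !t)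
    · rw [hab.1 ha, ha, D.alt_pow]; simp
    · by_cases ha' : a = (i, !s)
      · rcases hab.2 ha' with hb | hb
        · rw [hb, ha', D.alt_pow]; simp
        · subst ha' hb
          rw [y1, y2]
          simp only [map_add, map_smul, LinearMap.add_apply, LinearMap.smul_apply, pw, key4,
            P.pair2]
          rw [P.pair, P.pair]
          simp only [hij, false_and, if_false, Bool.not_eq_eq_eq_not, ne_eq, Bool.not_not, true_and,
            smul_eq_mul, mul_zero, add_zero, zero_add]
          have e1 : (!s) ≠ s := by cases s <;> simp
          have e2 : ¬ (t = !t) := by cases t <;> simp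
          simp only [e2]
          have : (p + l + 1 = lam i) ↔ (p + k + 1 = lam j) := by omega
          simp only [this]
          cases s <;> simp [add_self_F]
      · rw [y3 a ha' ha]
        by_cases hb : b = (i, !s)
        · rw [hb, y1, map_add, map_smul, P.pair, D.symm _ ((D.T ^ k) _), D.adj2, key1 _ a ha]
          simp
        · by_cases hb' : b = (j, !t)
          · rw [hb', y2, map_add, map_smul, P.pair, D.symm _ ((D.T ^ l) _), D.adj2,
              key2 _ a ha']
            simp
          · rw [y3 b hb hb', P.pair]
  refine ⟨P.pos, fun a => ?_, fun p a b => ?_⟩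
  · by_cases ha : a = (i, !s)
    · subst ha
      rw [y1, map_add, P.kill (i, !s), map_smul]
      simp only [hk, smul_zero, add_zero]
    · by_cases ha2 : a = (j, !t)
      · subst ha2
        rw [y2, map_add, P.kill (j, !t), map_smul]
        simp only [hl, smul_zero, add_zero]
      · rw [y3 a ha ha2, P.kill]
  · by_cases hab : (a = (j, !t) → b = (j, !t)) ∧ (a = (i, !s) → b = (i, !s) ∨ b = (j, !t))
    · exact main p a b hab
    · rw [D.adj_pow, D.symm, main p b a ?_]
      · congr 1
        simp only [eq_iff_iff]
        constructor
        · rintro ⟨h1, h2, h3⟩; exact ⟨h1.symm, h2.symm, by rw [← h1]; exact h3⟩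
        · rintro ⟨h1, h2, h3⟩; exact ⟨h1.symm, h2.symm, by rw [← h1]; exact h3⟩
      · by_contra hcon
        apply hab
        refine ⟨?_, ?_⟩
        · intro h
          by_contra h'
          apply hcon
          refine ⟨fun h2 => absurd h2 h', fun h2 => Or.inr h⟩
        · intro h
          by_contra h'
          apply hcon
          push Not at h'
          refine ⟨fun h2 => absurd h2 h'.2, fun h2 => absurd h2 h'.1⟩

theorem aeval_adj (u : Polynomial F) (v w : W) :
    D.B (Polynomial.aeval D.T u v) w = D.B v (Polynomial.aeval D.T u w) := by
  induction u using Polynomial.induction_on' with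
  | add p q hp hq => simp [hp, hq]
  | monomial n a => simp [Polynomial.aeval_monomial, D.adj_pow]

theorem aeval_perp (u : Polynomial F) (v w : W) (h : ∀ p, D.B ((D.T ^ p) v) w = 0) (p : ℕ) :
    D.B ((D.T ^ p) v) (Polynomial.aeval D.T u w) = 0 := by
  induction u using Polynomial.induction_on' with
  | add p q hp hq => simp [hp, hq]
  | monomial n a => simp [Polynomial.aeval_monomial, D.adj2, h]

theorem aeval_comm (u : Polynomial F) (p : ℕ) (w : W) :
    (D.T ^ p) (Polynomial.aeval D.T u w) = Polynomial.aeval D.T u ((D.T ^ p) w) := by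
  have : (D.T ^ p) = Polynomial.aeval D.T (Polynomial.X ^ p : Polynomial F) := by simp
  rw [this, ← Module.End.mul_apply, ← map_mul, mul_comm, map_mul]; rfl

/-- Move 3. -/
theorem PF.move3 (P : D.PF lam x) (i : Fin r) (s : Bool) (u u' : Polynomial F)
    (hU : ∀ w, Polynomial.aeval D.T u (Polynomial.aeval D.T u' w) = w) :
    D.PF lam (Function.update (Function.update x (i, s) (Polynomial.aeval D.T u (x (i, s))))
      (i, !s) (Polynomial.aeval D.T u' (x (i, !s)))) := by
  classical
  set y := Function.update (Function.update x (i, s) (Polynomial.aeval D.T u (x (i, s))))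
      (i, !s) (Polynomial.aeval D.T u' (x (i, !s))) with hy
  have hne : ((i, s) : Fin r × Bool) ≠ (i, !s) := by
    intro h; have := congrArg Prod.snd h; cases s <;> simp at this
  have y1 : y (i, s) = Polynomial.aeval D.T u (x (i, s)) := by
    rw [hy, Function.update_of_ne hne, Function.update_self]
  have y2 : y (i, !s) = Polynomial.aeval D.T u' (x (i, !s)) := by
    rw [hy, Function.update_self]
  have y3 : ∀ a, a.1 ≠ i → y a = x a := by
    intro a h1
    rw [hy, Function.update_of_ne, Function.update_of_ne] <;> rintro rfl <;> exact h1 rfl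
  have y4 : ∀ t, ∃ v : Polynomial F, y (i, t) = Polynomial.aeval D.T v (x (i, t)) := by
    intro t
    by_cases h : t = s
    · exact ⟨u, by rw [h, y1]⟩
    · have : t = !s := by rw [← bool_ne_iff]; exact Ne.symm h
      exact ⟨u', by rw [this, y2]⟩
  have perp : ∀ p a t, a.1 ≠ i → D.B ((D.T ^ p) (x a)) (y (i, t)) = 0 := by
    intro p a t ha
    obtain ⟨v, hv⟩ := y4 t
    rw [hv]
    apply aeval_perp
    intro p
    rw [P.pair, if_neg]
    rintro ⟨h, -⟩; exact ha h
  have hsn : ∀ p, D.B ((D.T ^ p) (y (i, s))) (y (i, !s)) = if p + 1 = lam i then 1 else 0 := by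
    intro p
    rw [y1, y2, aeval_comm, aeval_adj, hU, P.pair]
    simp only [true_and, ne_eq]
    have : ¬ (s = !s) := by cases s <;> simp
    simp [this]
  refine ⟨P.pos, fun a => ?_, fun p a b => ?_⟩
  · by_cases ha : a.1 = i
    · obtain ⟨j, t⟩ := a
      simp only at ha
      subst ha
      obtain ⟨v, hv⟩ := y4 t
      rw [hv, aeval_comm, P.kill (j, t), map_zero]
    · rw [y3 a ha, P.kill]
  · by_cases ha : a.1 = i
    · obtain ⟨j, t⟩ := a
      simp only at ha
      subst ha
      by_cases hb : b.1 = j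
      · obtain ⟨j', t'⟩ := b
        simp only at hb
        subst hb
        by_cases htt : t = t'
        · rw [htt, D.alt_pow]; simp
        · have h1 : t' = !t := bool_ne_iff.1 htt
          simp only [true_and, ne_eq, htt, not_false_eq_true]
          by_cases hts : t = s
          · rw [h1, hts, hsn]
          · have h2 : t = !s := bool_ne_iff.1 (Ne.symm hts)
            have h3 : t' = s := by rw [h1, h2, Bool.not_not]
            rw [h3, h2, D.adj_pow, D.symm, hsn]
      · rw [y3 b hb, D.adj_pow, D.symm, perp _ _ _ hb, if_neg]
        rintro ⟨h, -⟩; exact hb h.symm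
    · by_cases hb : b.1 = i
      · obtain ⟨j', t'⟩ := b
        simp only at hb
        subst hb
        rw [y3 a ha, perp _ _ _ ha, if_neg]
        rintro ⟨h, -⟩; exact ha h
      · rw [y3 a ha, y3 b hb, P.pair]

variable (D) in
theorem exists_inv (c : F) (k : ℕ) : ∃ u' : Polynomial F,
    ∀ w, Polynomial.aeval D.T (1 + Polynomial.C c * Polynomial.X ^ (k + 1))
      (Polynomial.aeval D.T u' w) = w := by
  obtain ⟨N, hN⟩ := D.nil
  set z : Polynomial F := Polynomial.C c * Polynomial.X ^ (k + 1) with hz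
  refine ⟨∑ i ∈ Finset.range N, z ^ i, fun w => ?_⟩
  have h1 : (1 + z) * ∑ i ∈ Finset.range N, z ^ i = 1 - z ^ N := by
    have : (1 : Polynomial F) + z = 1 - z := (CharTwo.sub_eq_add 1 z).symm
    rw [this, mul_neg_geom_sum]
  have h2 : Polynomial.aeval D.T (z ^ N) = 0 := by
    rw [hz, mul_pow, map_mul, ← pow_mul, mul_comm (k + 1) N, pow_mul, map_pow, map_pow,
      map_pow, Polynomial.aeval_X, hN, zero_pow (by omega), mul_zero]
  rw [← Module.End.mul_apply, ← map_mul, h1, map_sub, h2]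
  simp

/-- Swap. -/
theorem PF.swap (P : D.PF lam x) (i : Fin r) :
    D.PF lam (fun a => x (a.1, if a.1 = i then !a.2 else a.2)) := by
  refine ⟨P.pos, fun a => P.kill (a.1, if a.1 = i then !a.2 else a.2), fun p a b => ?_⟩
  rw [P.pair]
  congr 1
  simp only [eq_iff_iff]
  constructor
  · rintro ⟨h1, h2, h3⟩
    refine ⟨h1, ?_, h3⟩
    rintro h4; apply h2; rw [h1, h4]
  · rintro ⟨h1, h2, h3⟩
    refine ⟨h1, ?_, h3⟩
    rw [h1]
    split_ifs <;> simpa using h2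

/-! Basis. -/
section basis
variable [FiniteDimensional F W]

theorem Fr.span_top (R : D.Fr lam x) :
    Submodule.span F (Set.range (fun u : PF.Ix lam => PF.X D x u)) = ⊤ := by
  apply R.linInd.span_eq_top_of_card_eq_finrank'
  rw [PF.card_Ix, R.dim]

noncomputable def Fr.basis (R : D.Fr lam x) : Basis (PF.Ix lam) F W :=
  Basis.mk R.linInd R.span_top.ge

theorem Fr.basis_apply (R : D.Fr lam x) (u : PF.Ix lam) : R.basis u = (D.T ^ (u.2 : ℕ)) (x u.1) := by
  rw [Fr.basis, Basis.mk_apply]; rfl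

theorem Fr.expand (R : D.Fr lam x) (w : W) :
    w = ∑ u : PF.Ix lam, D.B w (PF.Y D x u) • PF.X D x u := by
  conv_lhs => rw [← R.basis.sum_repr w]
  apply Finset.sum_congr rfl
  intro u _
  have h : D.B w (PF.Y D x u) = R.basis.repr w u := by
    conv_lhs => rw [← R.basis.sum_repr w]
    simp only [map_sum, LinearMap.sum_apply, map_smul, LinearMap.smul_apply, smul_eq_mul]
    rw [Finset.sum_eq_single u]
    · have : R.basis u = PF.X D x u := R.basis_apply u
      rw [this, R.XY]; simp
    · intro v _ hv
      have : R.basis v = PF.X D x v := R.basis_apply v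
      rw [this, R.XY]; simp [hv]
    · simp
  rw [h]
  congr 1
  exact R.basis_apply u

/-- the generators of ker T^m -/
def gens (D : FS F W) (lam : Fin r → ℕ) (x : Fin r × Bool → W) (m : ℕ) : Set W :=
  {w | ∃ p a, lam a.1 ≤ m + p ∧ w = (D.T ^ p) (x a)}

theorem Fr.ker_le (R : D.Fr lam x) (m : ℕ) {w : W} (hw : (D.T ^ m) w = 0) :
    w ∈ Submodule.span F (gens D lam x m) := by
  rw [R.expand w]
  refine Submodule.sum_mem _ fun u _ => ?_
  by_cases h : lam u.1.1 ≤ m + u.2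
  · exact Submodule.smul_mem _ _ (Submodule.subset_span ⟨u.2, u.1, h, rfl⟩)
  · have : D.B w (PF.Y D x u) = 0 := by
      obtain ⟨⟨i, s⟩, p, hp⟩ := u
      simp only at hp h
      simp only [PF.Y]
      have e : lam i - 1 - p = m + (lam i - 1 - p - m) := by omega
      rw [e, ← pw, ← D.adj_pow, hw]; simp
    rw [this, zero_smul]; exact Submodule.zero_mem _

theorem Fr.crit (R : D.Fr lam x) (m j : ℕ)
    (h1 : ∀ g ∈ gens D lam x m, D.ka ((D.T ^ j) g) = 0)
    (h2 : ∀ g ∈ gens D lam x m, ∀ g' ∈ gens D lam x m, D.B ((D.T ^ (2 * j + 2)) g) g' = 0) :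
    D.H m j := by
  intro w hw
  replace hw := R.ker_le m hw
  have h3 : ∀ v ∈ Submodule.span F (gens D lam x m), ∀ g ∈ gens D lam x m,
      D.B ((D.T ^ (2 * j + 2)) v) g = 0 := by
    intro v hv g hg
    induction hv using Submodule.span_induction with
    | mem v hv => exact h2 v hv g hg
    | zero => simp
    | add a b _ _ ha hb => simp [ha, hb]
    | smul c a _ ha => simp [ha]
  have h4 : ∀ v ∈ Submodule.span F (gens D lam x m), ∀ g ∈ Submodule.span F (gens D lam x m),
      D.B ((D.T ^ (2 * j + 2)) v) g = 0 := by
    intro v hv g hg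
    induction hg using Submodule.span_induction with
    | mem g hg => exact h3 v hv g hg
    | zero => simp
    | add a b _ _ ha hb => simp [ha, hb]
    | smul c a _ ha => simp [ha]
  induction hw using Submodule.span_induction with
  | mem v hv => exact h1 v hv
  | zero => simp [D.ka_zero]
  | add a b ha' hb' ha hb => rw [D.ka_pow_add, ha, hb, h4 a ha' b hb']; simp
  | smul c a _ ha => rw [D.ka_pow_smul, ha, mul_zero]

/-- converse direction: elements killed -/
theorem Fr.lam_le (R : D.Fr lam x) (i : Fin r) : lam i ≤ 2 * D.h (lam i) + 2 := by
  by_contra hcon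
  push Not at hcon
  set j := D.h (lam i) with hj
  set q := lam i - 1 - (2 * j + 2) with hq
  have e1 : (D.T ^ lam i) ((D.T ^ q) (x (i, true))) = 0 := by
    rw [pw]; exact R.kill_le (by simp)
  have e2 : (D.T ^ lam i) (x (i, false)) = 0 := R.kill (i, false)
  have h1 := D.H_h (lam i) _ e1
  have h2 := D.H_h (lam i) _ e2
  have h3 := D.H_h (lam i) ((D.T ^ q) (x (i, true)) + x (i, false)) (by rw [map_add, e1, e2, add_zero])
  rw [D.ka_pow_add, h1, h2, pw, R.pair] at h3
  rw [if_pos ⟨rfl, by simp, by simp only; omega⟩] at h3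
  simp at h3

theorem exists_gen (R : D.Fr lam x) (i : Fin r) (hh : 1 ≤ D.h (lam i)) (hl : lam i ≤ 2 * D.h (lam i)) :
    ∃ a : Fin r × Bool, D.ka ((D.T ^ (D.h (lam i) - 1 + (lam a.1 - lam i))) (x a)) ≠ 0 := by
  by_contra hcon
  push Not at hcon
  have : D.H (lam i) (D.h (lam i) - 1) := by
    apply R.crit
    · rintro g ⟨p, a, hp, rfl⟩
      rw [pw]
      by_cases h : p = lam a.1 - lam i
      · rw [h]; exact hcon a
      · have e : D.h (lam i) - 1 + p = D.h (lam i) + (p - 1) := by omega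
        rw [e, ← pw]
        apply D.H_h
        rw [pw]
        exact R.kill_le (by omega)
    · rintro g ⟨p, a, hp, rfl⟩ g' _
      rw [pw, R.kill_le (by omega)]; simp
  have := D.h_le_iff.2 this
  omega

end basis

end FS

namespace FS

variable {F W : Type*} [Field F] [CharP F 2] [AddCommGroup W] [Module F W]
variable {D : FS F W} {r : ℕ} {lam : Fin r → ℕ} {x : Fin r × Bool → W}
variable [FiniteDimensional F W]

/-- goodness of a frame at an index -/
def Good (D : FS F W) (lam : Fin r → ℕ) (x : Fin r × Bool → W) (i : Fin r) : Prop :=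
  lam i ≠ 2 * D.h (lam i) + 2 → 1 ≤ D.h (lam i) →
    D.ka ((D.T ^ (D.h (lam i) - 1)) (x (i, true))) ≠ 0

theorem Fr.good_step (R : D.Fr lam x) (i : Fin r) :
    ∃ y, D.Fr lam y ∧ Good D lam y i ∧ ∀ j, j ≠ i → 1 ≤ D.h (lam j) →
      D.ka ((D.T ^ (D.h (lam j) - 1)) (y (j, true))) =
      D.ka ((D.T ^ (D.h (lam j) - 1)) (x (j, true))) := by
  classical
  by_cases hg : Good D lam x i
  · exact ⟨x, R, hg, fun _ _ _ => rfl⟩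
  unfold Good at hg
  push Not at hg
  obtain ⟨h1, h2, h3⟩ := hg
  by_cases h4 : D.ka ((D.T ^ (D.h (lam i) - 1)) (x (i, false))) = 0
  swap
  · refine ⟨_, ⟨R.swap i, R.dim⟩, fun _ _ => by simpa using h4, fun j hj _ => by simp [hj]⟩
  have h5 := R.lam_le i
  by_cases h6 : lam i = 2 * D.h (lam i) + 1
  · refine ⟨_, ⟨R.move1 i false 1 0, R.dim⟩, fun _ _ => ?_, fun j hj _ => ?_⟩
    · simp only [Bool.not_false, Function.update_self]
      rw [R.ka_move, h3]
      simp only [add_zero, h4]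
      rw [if_pos ⟨trivial, by simp, by omega⟩]
      simp
    · rw [Function.update_of_ne]
      simp [hj]
  · obtain ⟨⟨j, t⟩, ha⟩ := exists_gen R i h2 (by omega)
    simp only at ha
    have hij : i ≠ j := by
      rintro rfl
      simp only [Nat.sub_self, add_zero] at ha
      cases t
      · exact ha h4
      · exact ha h3
    have hl := D.h_lip (m := lam j) (m' := max (lam i) (lam j)) (le_max_right _ _)
    have hm := D.h_mono (m := lam i) (m' := max (lam i) (lam j)) (le_max_left _ _)
    refine ⟨_, ⟨R.move4 i j hij false t 1 (lam j - lam i) (lam i - lam j) (by omega), R.dim⟩,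
      fun _ _ => ?_, fun j' hj hj1 => ?_⟩
    · rw [Function.update_of_ne (by simp [hij])]
      simp only [Bool.not_false, Function.update_self]
      rw [R.ka_move, h3]
      simp only [hij, false_and, if_false]
      simpa using ha
    · by_cases hjj : j' = j
      · subst hjj
        cases t
        · simp only [Bool.not_false, Function.update_self]
          rw [R.ka_move]
          simp only [hij.symm, false_and, if_false]
          have : D.ka ((D.T ^ (D.h (lam j') - 1 + (lam i - lam j'))) (x (i, false))) = 0 := by
            by_cases hh : D.h (lam i) ≤ D.h (lam j') - 1 + (lam i - lam j')
            · exact D.ka_eq_zero hh (R.kill (i, false))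
            · have e : D.h (lam j') - 1 + (lam i - lam j') = D.h (lam i) - 1 := by omega
              rw [e]; exact h4
          rw [this]; simp
        · rw [Function.update_of_ne (by simp), Function.update_of_ne (by simp [hij.symm])]
      · rw [Function.update_of_ne (by simp [hjj]), Function.update_of_ne (by simp [hj])]

theorem Fr.exists_good (R : D.Fr lam x) : ∃ y, D.Fr lam y ∧ ∀ i, Good D lam y i := by
  classical
  have : ∀ S : Finset (Fin r), ∃ y, D.Fr lam y ∧ ∀ i ∈ S, Good D lam y i := by
    intro S
    induction S using Finset.induction_on with
    | empty => exact ⟨x, R, by simp⟩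
    | insert a S ha ih =>
      obtain ⟨y, hy, hg⟩ := ih
      obtain ⟨z, hz, hg1, hg2⟩ := hy.good_step a
      refine ⟨z, hz, fun i hi => ?_⟩
      by_cases hia : i = a
      · rw [hia]; exact hg1
      · intro h1 h2
        rw [hg2 i hia h2]
        exact hg i (by simpa [hia] using hi) h1 h2
  obtain ⟨y, hy, hg⟩ := this Finset.univ
  exact ⟨y, hy, fun i => hg i (Finset.mem_univ _)⟩

/-- normal form at an index -/
def NFi (D : FS F W) (lam h : Fin r → ℕ) (x : Fin r × Bool → W) (dl : Fin r → F) (i : Fin r) : Prop :=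
  (lam i = 2 * h i + 2 → ∀ p s, D.ka ((D.T ^ p) (x (i, s))) = 0) ∧
  (lam i ≠ 2 * h i + 2 → ∀ p, D.ka ((D.T ^ p) (x (i, true))) = if p + 1 = h i then 1 else 0) ∧
  (lam i ≠ 2 * h i + 2 → ∀ p, D.ka ((D.T ^ p) (x (i, false))) =
    if p + 2 + h i = lam i then dl i else 0)

theorem Fr.norm_dbl (R : D.Fr lam x) (i : Fin r) (s : Bool) (hl : lam i = 2 * D.h (lam i) + 2) :
    ∃ y, D.Fr lam y ∧ (∀ a, a ≠ (i, !s) → y a = x a) ∧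
      ∀ p, D.ka ((D.T ^ p) (y (i, !s))) = 0 := by
  classical
  have hne : ((i, s) : Fin r × Bool) ≠ (i, !s) := by
    intro h; have := congrArg Prod.snd h; cases s <;> simp at this
  have hn2 : (!s) ≠ s := by cases s <;> simp
  have : ∀ k, ∃ y, D.Fr lam y ∧ (∀ a, a ≠ (i, !s) → y a = x a) ∧
      ∀ p, D.h (lam i) ≤ p + k → D.ka ((D.T ^ p) (y (i, !s))) = 0 := by
    intro k
    induction k with
    | zero => exact ⟨x, R, fun _ _ => rfl, fun p hp => D.ka_eq_zero hp (R.kill (i, !s))⟩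
    | succ k ih =>
      obtain ⟨y, hy, h1, h2⟩ := ih
      by_cases hk : k + 1 ≤ D.h (lam i)
      · obtain ⟨q, hq⟩ : ∃ q, q + k + 1 = D.h (lam i) := ⟨D.h (lam i) - (k + 1), by omega⟩
        refine ⟨_, ⟨hy.move1 i s (D.ka ((D.T ^ q) (y (i, !s)))) (lam i - 3 - 2 * q), hy.dim⟩,
          fun a ha => ?_, fun p hp => ?_⟩
        · rw [Function.update_of_ne ha, h1 a ha]
        · rw [Function.update_self, hy.ka_move]
          have : D.ka ((D.T ^ (p + (lam i - 3 - 2 * q))) (y (i, s))) = 0 :=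
            D.ka_eq_zero (m := lam i) (by omega) (hy.kill (i, s))
          rw [this]
          by_cases hpq : p = q
          · subst hpq
            rw [if_pos ⟨rfl, hn2, by simp only; omega⟩]
            simp [add_self_F]
          · rw [h2 p (by omega), if_neg]
            · simp
            · rintro ⟨-, -, h⟩; simp only at h; omega
      · exact ⟨y, hy, h1, fun p hp => h2 p (by omega)⟩
  obtain ⟨y, hy, h1, h2⟩ := this (D.h (lam i))
  exact ⟨y, hy, h1, fun p => h2 p (by omega)⟩

theorem Fr.norm_e (hsq : ∀ a : F, ∃ b, b ^ 2 = a) (R : D.Fr lam x) (i : Fin r)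
    (hl : lam i ≠ 2 * D.h (lam i) + 2) (hg : Good D lam x i) :
    ∃ y, D.Fr lam y ∧ (∀ a, a.1 ≠ i → y a = x a) ∧
      ∀ p, D.ka ((D.T ^ p) (y (i, true))) = if p + 1 = D.h (lam i) then 1 else 0 := by
  classical
  by_cases h0 : D.h (lam i) = 0
  · refine ⟨x, R, fun _ _ => rfl, fun p => ?_⟩
    rw [h0, if_neg (by omega)]
    exact D.ka_eq_zero (m := lam i) (by omega) (R.kill (i, true))
  have hg := hg hl (by omega)
  have : ∀ k, ∃ y, D.Fr lam y ∧ (∀ a, a.1 ≠ i → y a = x a) ∧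
      D.ka ((D.T ^ (D.h (lam i) - 1)) (y (i, true))) = 1 ∧
      ∀ p, p + 1 < D.h (lam i) → D.h (lam i) ≤ p + 1 + k → D.ka ((D.T ^ p) (y (i, true))) = 0 := by
    intro k
    induction k with
    | zero =>
      obtain ⟨c, hc⟩ := hsq (D.ka ((D.T ^ (D.h (lam i) - 1)) (x (i, true))))⁻¹
      have hc0 : c ≠ 0 := by
        rintro rfl
        apply hg
        rw [← inv_eq_zero, ← hc]; simp
      refine ⟨_, ⟨R.move3 i true (Polynomial.C c) (Polynomial.C c⁻¹) ?_, R.dim⟩, ?_, ?_, ?_⟩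
      · intro w
        rw [← Module.End.mul_apply, ← map_mul, ← Polynomial.C_mul, mul_inv_cancel₀ hc0]
        simp
      · intro a ha
        rw [Function.update_of_ne, Function.update_of_ne] <;> rintro rfl <;> exact ha rfl
      · rw [Function.update_of_ne (by simp), Function.update_self]
        simp only [Polynomial.aeval_C, Module.algebraMap_end_apply]
        rw [D.ka_pow_smul, hc, inv_mul_cancel₀ hg]
      · intro p h1 h2; omega
    | succ k ih =>
      obtain ⟨y, hy, h1, h2, h3⟩ := ih
      by_cases hk : k + 2 ≤ D.h (lam i)
      · obtain ⟨q, hq⟩ : ∃ q, q + k + 2 = D.h (lam i) := ⟨D.h (lam i) - (k + 2), by omega⟩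
        obtain ⟨c, hc⟩ := hsq (D.ka ((D.T ^ q) (y (i, true))))
        obtain ⟨u', hu'⟩ := D.exists_inv c k
        have hval : ∀ p, D.ka ((D.T ^ p) (Polynomial.aeval D.T
            (1 + Polynomial.C c * Polynomial.X ^ (k + 1)) (y (i, true)))) =
            D.ka ((D.T ^ p) (y (i, true))) + c ^ 2 * D.ka ((D.T ^ (p + (k + 1))) (y (i, true))) := by
          intro p
          have e : Polynomial.aeval D.T
            (1 + Polynomial.C c * Polynomial.X ^ (k + 1)) (y (i, true)) =
            y (i, true) + c • (D.T ^ (k + 1)) (y (i, true)) := by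
            simp [Polynomial.aeval_C, Module.algebraMap_end_apply]
          rw [e, hy.ka_move]
          simp
        refine ⟨_, ⟨hy.move3 i true _ u' hu', hy.dim⟩, ?_, ?_, ?_⟩
        · intro a ha
          rw [Function.update_of_ne, Function.update_of_ne, h1 a ha] <;> rintro rfl <;> exact ha rfl
        · rw [Function.update_of_ne (by simp), Function.update_self, hval, h2,
            D.ka_eq_zero (m := lam i) (by omega) (hy.kill (i, true))]
          simp
        · intro p hp1 hp2
          rw [Function.update_of_ne (by simp), Function.update_self, hval]
          by_cases hpq : p = q
          · subst hpq
            have e : p + (k + 1) = D.h (lam i) - 1 := by omega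
            rw [e, h2, hc, mul_one, add_self_F]
          · rw [h3 p hp1 (by omega),
              D.ka_eq_zero (m := lam i) (by omega) (hy.kill (i, true))]
            simp
      · exact ⟨y, hy, h1, h2, fun p hp1 hp2 => h3 p hp1 (by omega)⟩
  obtain ⟨y, hy, h1, h2, h3⟩ := this (D.h (lam i))
  refine ⟨y, hy, h1, fun p => ?_⟩
  split_ifs with h
  · have : p = D.h (lam i) - 1 := by omega
    rw [this, h2]
  · by_cases h' : p + 1 < D.h (lam i)
    · exact h3 p h' (by omega)
    · exact D.ka_eq_zero (m := lam i) (by omega) (hy.kill (i, true))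

/-- M1 effect when `e` is normalized with hh. -/
theorem PF.ka_m1 (P : D.PF lam x) (i : Fin r) (hh : ℕ)
    (he : ∀ p, D.ka ((D.T ^ p) (x (i, true))) = if p + 1 = hh then 1 else 0) (c : F) (k p : ℕ) :
    D.ka ((D.T ^ p) ((Function.update x (i, !true) (x (i, !true) + c • (D.T ^ k) (x (i, true))))
      (i, false))) = D.ka ((D.T ^ p) (x (i, false))) + (if p + k + 1 = hh then c ^ 2 else 0) +
        (if 2 * p + 2 + k + 1 = lam i then c else 0) := by
  simp only [Bool.not_true, Function.update_self]
  rw [P.ka_move, he]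
  simp

theorem Fr.norm_f (hsq : ∀ a : F, ∃ b, b ^ 2 = a) (R : D.Fr lam x) (i : Fin r)
    (he : ∀ p, D.ka ((D.T ^ p) (x (i, true))) = if p + 1 = D.h (lam i) then 1 else 0) :
    ∃ y, D.Fr lam y ∧ (∀ a, a ≠ (i, false) → y a = x a) ∧
      ∀ p, p + 2 + D.h (lam i) ≠ lam i → D.ka ((D.T ^ p) (y (i, false))) = 0 := by
  classical
  have hle := R.lam_le i
  set hh := D.h (lam i) with hhd
  -- stage one
  have s1 : ∀ k, ∃ y, D.Fr lam y ∧ (∀ a, a ≠ (i, false) → y a = x a) ∧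
      ∀ p, lam i < p + 2 + hh → hh ≤ p + k → D.ka ((D.T ^ p) (y (i, false))) = 0 := by
    intro k
    induction k with
    | zero => exact ⟨x, R, fun _ _ => rfl, fun p _ hp => D.ka_eq_zero hp (R.kill (i, false))⟩
    | succ k ih =>
      obtain ⟨y, hy, h1, h2⟩ := ih
      by_cases hk : k + 1 ≤ hh ∧ lam i < (hh - (k + 1)) + 2 + hh
      · obtain ⟨hk, hk2⟩ := hk
        obtain ⟨q, hq⟩ : ∃ q, q + k + 1 = hh := ⟨hh - (k + 1), by omega⟩
        obtain ⟨c, hc⟩ := hsq (D.ka ((D.T ^ q) (y (i, false))))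
        have he' : ∀ p, D.ka ((D.T ^ p) (y (i, true))) = if p + 1 = hh then 1 else 0 := by
          intro p; rw [h1 _ (by simp), he]
        refine ⟨_, ⟨hy.move1 i true c (hh - 1 - q), hy.dim⟩, fun a ha => ?_, fun p hp1 hp2 => ?_⟩
        · rw [Function.update_of_ne (by simpa using ha), h1 a ha]
        · rw [hy.ka_m1 i hh he']
          rw [if_neg (c := 2 * p + 2 + (hh - 1 - q) + 1 = lam i) (by omega), add_zero]
          by_cases hpq : p = q
          · subst hpq
            rw [if_pos (by omega), hc, add_self_F]
          · rw [if_neg (by omega), h2 p hp1 (by omega), add_zero]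
      · exact ⟨y, hy, h1, fun p hp1 hp2 => h2 p hp1 (by omega)⟩
  obtain ⟨y, hy, h1, h2⟩ := s1 hh
  have s2 : ∀ k, ∃ y, D.Fr lam y ∧ (∀ a, a ≠ (i, false) → y a = x a) ∧
      (∀ p, lam i < p + 2 + hh → D.ka ((D.T ^ p) (y (i, false))) = 0) ∧
      (∀ p, p + 2 + hh < lam i → p < k → D.ka ((D.T ^ p) (y (i, false))) = 0) := by
    intro k
    induction k with
    | zero => exact ⟨y, hy, h1, fun p hp => h2 p hp (by omega), fun p _ hp => by omega⟩
    | succ k ih =>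
      obtain ⟨y, hy, h1, h2, h3⟩ := ih
      by_cases hk : k + 2 + hh < lam i
      · obtain ⟨c, hc⟩ := hsq (D.ka ((D.T ^ k) (y (i, false))))
        have he' : ∀ p, D.ka ((D.T ^ p) (y (i, true))) = if p + 1 = hh then 1 else 0 := by
          intro p; rw [h1 _ (by simp), he]
        refine ⟨_, ⟨hy.move1 i true c (hh - 1 - k), hy.dim⟩, fun a ha => ?_, fun p hp => ?_,
          fun p hp1 hp2 => ?_⟩
        · rw [Function.update_of_ne (by simpa using ha), h1 a ha]
        · rw [hy.ka_m1 i hh he', if_neg (by omega), if_neg (by omega), h2 p hp]; simp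
        · rw [hy.ka_m1 i hh he']
          rw [if_neg (c := 2 * p + 2 + (hh - 1 - k) + 1 = lam i) (by omega), add_zero]
          by_cases hpq : p = k
          · subst hpq
            rw [if_pos (by omega), hc, add_self_F]
          · rw [if_neg (by omega), h3 p hp1 (by omega), add_zero]
      · exact ⟨y, hy, h1, h2, fun p hp1 hp2 => h3 p hp1 (by omega)⟩
  obtain ⟨y, hy, h1, h2, h3⟩ := s2 (lam i)
  refine ⟨y, hy, h1, fun p hp => ?_⟩
  rcases lt_or_gt_of_ne hp with h | h
  · exact h3 p h (by omega)
  · exact h2 p h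

theorem Fr.norm_step (hsq : ∀ a : F, ∃ b, b ^ 2 = a) (R : D.Fr lam x) (i : Fin r)
    (hg : Good D lam x i) :
    ∃ y d, D.Fr lam y ∧ (∀ a, a.1 ≠ i → y a = x a) ∧
      NFi D lam (fun i => D.h (lam i)) y (fun _ => d) i := by
  by_cases hl : lam i = 2 * D.h (lam i) + 2
  · obtain ⟨y, hy, h1, h2⟩ := R.norm_dbl i true hl
    obtain ⟨z, hz, h3, h4⟩ := hy.norm_dbl i false hl
    refine ⟨z, 0, hz, fun a ha => ?_, fun _ p s => ?_, fun h => absurd hl h, fun h => absurd hl h⟩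
    · rw [h3, h1] <;> rintro rfl <;> exact ha rfl
    · cases s
      · rw [h3 _ (by simp)]; exact h2 p
      · exact h4 p
  · obtain ⟨y, hy, h1, h2⟩ := R.norm_e hsq i hl hg
    obtain ⟨z, hz, h3, h4⟩ := hy.norm_f hsq i h2
    refine ⟨z, D.ka ((D.T ^ (lam i - 2 - D.h (lam i))) (z (i, false))), hz, fun a ha => ?_,
      fun h => absurd h hl, fun _ p => ?_, fun _ p => ?_⟩
    · rw [h3, h1 a ha]; rintro rfl; exact ha rfl
    · rw [h3 _ (by simp), h2]
    · split_ifs with h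
      · simp only at h
        have : p = lam i - 2 - D.h (lam i) := by omega
        rw [this]
      · exact h4 p h

/-- the normal form of a structure -/
structure NF (D : FS F W) (lam h : Fin r → ℕ) (x : Fin r × Bool → W) (dl : Fin r → F) : Prop
    extends D.Fr lam x where
  nfi : ∀ i, NFi D lam h x dl i

theorem Fr.exists_NF0 (hsq : ∀ a : F, ∃ b, b ^ 2 = a) (R : D.Fr lam x) :
    ∃ y dl, NF D lam (fun i => D.h (lam i)) y dl := by
  classical
  obtain ⟨x, R, hg⟩ := R.exists_good
  have : ∀ S : Finset (Fin r), ∃ y dl, D.Fr lam y ∧ (∀ i ∈ S, NFi D lam (fun i => D.h (lam i)) y dl i)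
      ∧ ∀ i ∉ S, Good D lam y i := by
    intro S
    induction S using Finset.induction_on with
    | empty => exact ⟨x, 0, R, by simp, fun i _ => hg i⟩
    | insert a S ha ih =>
      obtain ⟨y, dl, hy, h1, h2⟩ := ih
      obtain ⟨z, d, hz, h3, h4⟩ := hy.norm_step hsq a (h2 a ha)
      refine ⟨z, Function.update dl a d, hz, fun i hi => ?_, fun i hi => ?_⟩
      · by_cases hia : i = a
        · subst hia
          unfold NFi at h4 ⊢
          simpa using h4
        · have := h1 i (by simpa [hia] using hi)
          unfold NFi at this ⊢
          rw [Function.update_of_ne hia, h3 _ (by exact hia), h3 _ (by exact hia)]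
          refine ⟨fun h p s => ?_, this.2⟩
          rw [h3 _ (by exact hia)]
          exact this.1 h p s
      · simp only [Finset.mem_insert, not_or] at hi
        have := h2 i hi.2
        unfold Good at this ⊢
        rw [h3 _ (by exact hi.1)]
        exact this
  obtain ⟨y, dl, hy, h, -⟩ := this Finset.univ
  exact ⟨y, dl, hy, fun i => h i (Finset.mem_univ _)⟩

end FS

namespace FS

variable {F W : Type*} [Field F] [CharP F 2] [AddCommGroup W] [Module F W]
variable {D : FS F W} {r : ℕ} {lam h : Fin r → ℕ} {x : Fin r × Bool → W} {dl : Fin r → F}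
variable [FiniteDimensional F W]

/-- next value of h -/
def hn (h : Fin r → ℕ) (i : Fin r) : ℕ := if hi : (i : ℕ) + 1 < r then h ⟨i + 1, hi⟩ else 0

/-- break indices -/
def Bk (lam h : Fin r → ℕ) (i : Fin r) : Prop := h i + hn h i + 2 ≤ lam i ∧ lam i ≠ 2 * h i + 2

/-- change of parameter at one index -/
theorem NF.adj1 (N : NF D lam h x dl) (hl : ∀ i, lam i ≤ 2 * h i + 2) (b : Fin r)
    (hb : h b + 2 ≤ lam b) (hb2 : lam b ≠ 2 * h b + 2) (c : F) :
    ∃ y, (∀ i, y (i, true) = x (i, true)) ∧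
      NF D lam h y (Function.update dl b (dl b + (c ^ 2 + c))) := by
  classical
  have hlb := hl b
  have he := (N.nfi b).2.1 hb2
  have hf := (N.nfi b).2.2 hb2
  refine ⟨_, fun i => ?_, ⟨N.move1 b true c (2 * h b + 1 - lam b), N.dim⟩, fun i => ?_⟩
  · rw [Function.update_of_ne (by simp)]
  · by_cases hib : i = b
    · subst hib
      refine ⟨fun h => absurd h hb2, fun _ p => ?_, fun _ p => ?_⟩
      · rw [Function.update_of_ne (by simp), he]
      · rw [N.ka_m1 i (h i) he, hf, Function.update_self]
        by_cases hp : p + 2 + h i = lam i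
        · rw [if_pos hp, if_pos (by omega), if_pos (by omega), if_pos hp, add_assoc]
        · rw [if_neg hp, if_neg (by omega), if_neg (by omega), if_neg hp]; simp
    · have := N.nfi i
      unfold NFi at this ⊢
      rw [Function.update_of_ne hib, Function.update_of_ne (by simp [hib]),
        Function.update_of_ne (by simp [hib])]
      refine ⟨fun h p s => ?_, this.2⟩
      rw [Function.update_of_ne (by simp [hib])]
      exact this.1 h p s

theorem NF.adj (N : NF D lam h x dl) (hl : ∀ i, lam i ≤ 2 * h i + 2) (dl' : Fin r → F)
    (hd : ∀ i, dl' i = dl i ∨ (h i + 2 ≤ lam i ∧ lam i ≠ 2 * h i + 2 ∧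
      ∃ c, dl' i = dl i + (c ^ 2 + c))) :
    ∃ y, NF D lam h y dl' := by
  classical
  have : ∀ S : Finset (Fin r), ∃ y dl1, NF D lam h y dl1 ∧ (∀ i ∈ S, dl1 i = dl' i) ∧
      ∀ i ∉ S, dl1 i = dl i := by
    intro S
    induction S using Finset.induction_on with
    | empty => exact ⟨x, dl, N, by simp, by simp⟩
    | insert a S ha ih =>
      obtain ⟨y, dl1, hy, h1, h2⟩ := ih
      rcases hd a with hda | ⟨h3, h4, c, h5⟩
      · refine ⟨y, dl1, hy, fun i hi => ?_, fun i hi => ?_⟩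
        · rcases Finset.mem_insert.1 hi with rfl | hi
          · rw [h2 _ ha, hda]
          · exact h1 i hi
        · exact h2 i (fun h => hi (Finset.mem_insert_of_mem h))
      · obtain ⟨z, -, hz⟩ := hy.adj1 hl a h3 h4 c
        refine ⟨z, _, hz, fun i hi => ?_, fun i hi => ?_⟩
        · by_cases hia : i = a
          · subst hia
            rw [Function.update_self, h2 _ ha, h5]
          · rw [Function.update_of_ne hia]
            exact h1 i (by simpa [hia] using hi)
        · simp only [Finset.mem_insert, not_or] at hi
          rw [Function.update_of_ne hi.1]
          exact h2 i hi.2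
  obtain ⟨y, dl1, hy, h1, -⟩ := this Finset.univ
  have : dl1 = dl' := funext fun i => h1 i (Finset.mem_univ _)
  exact ⟨y, this ▸ hy⟩

theorem NF.congr (N : NF D lam h x dl) (dl' : Fin r → F)
    (hd : ∀ i, dl' i = dl i ∨ lam i = 2 * h i + 2 ∨ lam i < h i + 2) : NF D lam h x dl' := by
  refine ⟨N.toFr, fun i => ?_⟩
  have := N.nfi i
  refine ⟨this.1, this.2.1, fun hi p => ?_⟩
  rw [this.2.2 hi p]
  rcases hd i with h1 | h1 | h1
  · rw [h1]
  · exact absurd h1 hi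
  · rw [if_neg (by omega), if_neg (by omega)]

theorem NF.kill_next (hsq : ∀ a : F, ∃ b, b ^ 2 = a) (N : NF D lam h x dl) (i j : Fin r) (hij : i ≠ j)
    (hlam : lam j ≤ lam i) (h1 : lam i ≤ h i + h j + 1) (hi : lam i ≠ 2 * h i + 2)
    (hj : lam j ≠ 2 * h j + 2) :
    ∃ y dl', NF D lam h y dl' ∧ dl' i = 0 ∧ ∀ k, k ≠ i → k ≠ j → dl' k = dl k := by
  classical
  obtain ⟨c, hc⟩ := hsq (dl i)
  set k2 := h i + h j + 1 - lam i with hk2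
  set k1 := k2 + (lam i - lam j) with hk1
  have hei := (N.nfi i).2.1 hi
  have hej := (N.nfi j).2.1 hj
  have hfi := (N.nfi i).2.2 hi
  have hfj := (N.nfi j).2.2 hj
  refine ⟨_, Function.update (Function.update dl i 0) j (dl j + dl i),
    ⟨⟨N.move4 i j hij true true c k2 k1 (by omega), N.dim⟩, fun k => ?_⟩, ?_, ?_⟩
  · by_cases hki : k = i
    · subst hki
      refine ⟨fun h => absurd h hi, fun _ p => ?_, fun _ p => ?_⟩
      · rw [Function.update_of_ne (by simp), Function.update_of_ne (by simp), hei]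
      · rw [Function.update_of_ne (by simp [hij])]
        simp only [Bool.not_true, Function.update_self]
        rw [N.ka_move, hfi, hej, Function.update_of_ne hij, Function.update_self]
        simp only [hij, false_and, if_false]
        by_cases hp : p + 2 + h k = lam k
        · rw [if_pos hp, if_pos (by omega), hc]; simp [add_self_F]
        · rw [if_neg hp, if_neg (by omega)]; simp
    · by_cases hkj : k = j
      · subst hkj
        refine ⟨fun h => absurd h hj, fun _ p => ?_, fun _ p => ?_⟩
        · rw [Function.update_of_ne (by simp), Function.update_of_ne (by simp), hej]
        · simp only [Bool.not_true, Function.update_self]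
          rw [N.ka_move, hfj, hei]
          simp only [hki, false_and, if_false]
          by_cases hp : p + 2 + h k = lam k
          · rw [if_pos hp, if_pos (by omega), if_pos hp, hc]; simp
          · rw [if_neg hp, if_neg (by omega), if_neg hp]; simp
      · have := N.nfi k
        unfold NFi at this ⊢
        have e : ∀ s, Function.update (Function.update x (i, !true)
            (x (i, !true) + c • (D.T ^ k2) (x (j, true))))
            (j, !true) (x (j, !true) + c • (D.T ^ k1) (x (i, true))) (k, s) = x (k, s) := by
          intro s
          rw [Function.update_of_ne (by simp [hkj]), Function.update_of_ne (by simp [hki])]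
        simp only [e, Function.update_of_ne hkj, Function.update_of_ne hki]
        exact this
  · rw [Function.update_of_ne hij, Function.update_self]
  · intro k h1 h2
    rw [Function.update_of_ne h2, Function.update_of_ne h1]

theorem Fr.exists_NF (hsq : ∀ a : F, ∃ b, b ^ 2 = a) (R : D.Fr lam x) (hanti : Antitone lam) :
    ∃ y dl, NF D lam (fun i => D.h (lam i)) y dl ∧
      ∀ i, ¬ Bk lam (fun i => D.h (lam i)) i → dl i = 0 := by
  classical
  obtain ⟨x, dl, N⟩ := R.exists_NF0 hsq
  have : ∀ k, k ≤ r → ∃ y dl, NF D lam (fun i => D.h (lam i)) y dl ∧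
      ∀ i : Fin r, (i : ℕ) < k → ¬ Bk lam (fun i => D.h (lam i)) i → dl i = 0 := by
    intro k
    induction k with
    | zero => intro _; exact ⟨x, dl, N, fun i hi => by omega⟩
    | succ k ih =>
      intro hk
      obtain ⟨y, dl, hy, h1⟩ := ih (by omega)
      set i : Fin r := ⟨k, by omega⟩ with hi
      by_cases hb : Bk lam (fun i => D.h (lam i)) i
      · refine ⟨y, dl, hy, fun j hj hj2 => ?_⟩
        by_cases hji : j = i
        · exact absurd (hji ▸ hb) hj2
        · exact h1 j (by
            have : (j : ℕ) ≠ k := fun h => hji (Fin.ext h)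
            omega) hj2
      · by_cases hs : lam i = 2 * D.h (lam i) + 2 ∨ lam i < D.h (lam i) + 2
        · refine ⟨y, Function.update dl i 0, hy.congr _ fun j => ?_, fun j hj hj2 => ?_⟩
          · by_cases hji : j = i
            · right; rw [hji]; exact hs
            · left; rw [Function.update_of_ne hji]
          · by_cases hji : j = i
            · rw [hji, Function.update_self]
            · rw [Function.update_of_ne hji]
              exact h1 j (by
                have : (j : ℕ) ≠ k := fun h => hji (Fin.ext h)
                omega) hj2
        · push Not at hs
          unfold Bk at hb
          have hhn : ¬ (D.h (lam i) + hn (fun i => D.h (lam i)) i + 2 ≤ lam i) :=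
            fun h => hb ⟨h, hs.1⟩
          have hr : k + 1 < r := by
            by_contra hcon
            apply hhn
            unfold hn
            rw [dif_neg (by simpa [hi] using hcon)]
            omega
          set j : Fin r := ⟨k + 1, hr⟩ with hj
          have hnj : hn (fun i => D.h (lam i)) i = D.h (lam j) := by
            unfold hn; rw [dif_pos (by simpa [hi] using hr)]
          rw [hnj] at hhn
          have hlij : lam j ≤ lam i := hanti (by simp [hi, hj, Fin.le_def])
          have hlip := D.h_lip hlij
          have hij : i ≠ j := by simp [hi, hj]
          obtain ⟨z, dl', hz, h2, h3⟩ := hy.kill_next hsq i j hij hlij (by omega) hs.1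
            (by omega)
          refine ⟨z, dl', hz, fun l hl hl2 => ?_⟩
          by_cases hli : l = i
          · rw [hli, h2]
          · have hlk : (l : ℕ) < k := by
              have : (l : ℕ) ≠ k := fun h => hli (Fin.ext h)
              omega
            rw [h3 l hli (by rintro rfl; simp [hj] at hlk)]
            exact h1 l hlk hl2
  obtain ⟨y, dl, hy, h1⟩ := this r le_rfl
  exact ⟨y, dl, hy, fun i hi => h1 i i.2 hi⟩

/-- isomorphism of structures with the same normal form -/
theorem Fr.iso {W' : Type*} [AddCommGroup W'] [Module F W'] [FiniteDimensional F W']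
    {D' : FS F W'} {x' : Fin r × Bool → W'} (R : D.Fr lam x) (R' : D'.Fr lam x')
    (hka : ∀ p a, D.ka ((D.T ^ p) (x a)) = D'.ka ((D'.T ^ p) (x' a))) :
    ∃ g : W ≃ₗ[F] W', (∀ v w, D'.B (g v) (g w) = D.B v w) ∧ (∀ v, g (D.T v) = D'.T (g v)) ∧
      ∀ v, D'.ka (g v) = D.ka v := by
  let g : W ≃ₗ[F] W' := R.basis.equiv R'.basis (Equiv.refl _)
  have hg0 : ∀ u, g (R.basis u) = R'.basis u := by
    intro u; simp [g]
  have hg : ∀ p a, g ((D.T ^ p) (x a)) = (D'.T ^ p) (x' a) := by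
    intro p a
    by_cases hp : p < lam a.1
    · have := hg0 ⟨a, ⟨p, hp⟩⟩
      rwa [Fr.basis_apply, Fr.basis_apply] at this
    · rw [R.kill_le (by omega), R'.kill_le (by omega), map_zero]
  have hB : ∀ v w, D'.B (g v) (g w) = D.B v w := by
    have : (D'.B.compl₁₂ g.toLinearMap g.toLinearMap) = D.B := by
      refine R.basis.ext fun u => R.basis.ext fun u' => ?_
      simp only [LinearMap.compl₁₂_apply, LinearEquiv.coe_coe]
      rw [Fr.basis_apply, Fr.basis_apply, hg, hg, R.pair2, R'.pair2]
    intro v w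
    rw [← this]; simp
  have hT : ∀ v, g (D.T v) = D'.T (g v) := by
    have : g.toLinearMap ∘ₗ D.T = D'.T ∘ₗ g.toLinearMap := by
      refine R.basis.ext fun u => ?_
      simp only [LinearMap.comp_apply, LinearEquiv.coe_coe]
      rw [Fr.basis_apply, hg]
      have e1 : D.T ((D.T ^ (u.2 : ℕ)) (x u.1)) = (D.T ^ (1 + (u.2 : ℕ))) (x u.1) := by
        rw [← pw, pow_one]
      have e2 : D'.T ((D'.T ^ (u.2 : ℕ)) (x' u.1)) = (D'.T ^ (1 + (u.2 : ℕ))) (x' u.1) := by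
        rw [← pw, pow_one]
      rw [e1, hg, e2]
    intro v
    exact congrArg (fun f => f v) this
  refine ⟨g, hB, hT, fun v => ?_⟩
  have hv : v ∈ Submodule.span F (Set.range (fun u : PF.Ix lam => PF.X D x u)) := by
    rw [R.span_top]; trivial
  induction hv using Submodule.span_induction with
  | mem v hv =>
    obtain ⟨u, rfl⟩ := hv
    simp only [PF.X]
    rw [hg, hka]
  | zero => rw [map_zero, D.ka_zero, D'.ka_zero]
  | add a b _ _ ha hb => rw [map_add, D.ka_add, D'.ka_add, ha, hb, ← hT, ← hT, hB]
  | smul c a _ ha => rw [map_smul, D.ka_smul, D'.ka_smul, ha]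

theorem NF.ka_eq {W' : Type*} [AddCommGroup W'] [Module F W'] [FiniteDimensional F W']
    {D' : FS F W'} {x' : Fin r × Bool → W'} (N : NF D lam h x dl) (N' : NF D' lam h x' dl)
    (p : ℕ) (a : Fin r × Bool) : D.ka ((D.T ^ p) (x a)) = D'.ka ((D'.T ^ p) (x' a)) := by
  obtain ⟨i, s⟩ := a
  by_cases hl : lam i = 2 * h i + 2
  · rw [(N.nfi i).1 hl, (N'.nfi i).1 hl]
  · cases s
    · rw [(N.nfi i).2.2 hl, (N'.nfi i).2.2 hl]
    · rw [(N.nfi i).2.1 hl, (N'.nfi i).2.1 hl]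

theorem NF.iso {W' : Type*} [AddCommGroup W'] [Module F W'] [FiniteDimensional F W']
    {D' : FS F W'} {x' : Fin r × Bool → W'} (N : NF D lam h x dl) (N' : NF D' lam h x' dl) :
    ∃ g : W ≃ₗ[F] W', (∀ v w, D'.B (g v) (g w) = D.B v w) ∧ (∀ v, g (D.T v) = D'.T (g v)) ∧
      ∀ v, D'.ka (g v) = D.ka v :=
  N.toFr.iso N'.toFr (N.ka_eq N')

end FS

namespace FS

variable {F W : Type*} [Field F] [CharP F 2] [AddCommGroup W] [Module F W]
variable {D : FS F W} {r : ℕ} {lam h : Fin r → ℕ} {x : Fin r × Bool → W} {dl : Fin r → F}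
variable [FiniteDimensional F W]

theorem Fr.crit_iff (R : D.Fr lam x) (m j : ℕ) : D.H m j ↔
    (∀ p a, lam a.1 ≤ m + p → D.ka ((D.T ^ (j + p)) (x a)) = 0) ∧
    (∀ p (a : Fin r × Bool) p' (a' : Fin r × Bool), lam a.1 ≤ m + p → lam a'.1 ≤ m + p' →
      ¬ (a.1 = a'.1 ∧ a.2 ≠ a'.2 ∧ 2 * j + 2 + p + p' + 1 = lam a.1)) := by
  constructor
  · intro hH
    have h1 : ∀ p a, lam a.1 ≤ m + p → D.ka ((D.T ^ (j + p)) (x a)) = 0 := by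
      intro p a hp
      rw [← pw]
      apply hH
      rw [pw, R.kill_le hp]
    refine ⟨h1, ?_⟩
    intro p a p' a' hp hp' hc
    have h2 := hH ((D.T ^ p) (x a) + (D.T ^ p') (x a')) (by
      rw [map_add, pw, pw, R.kill_le hp, R.kill_le hp', add_zero])
    rw [D.ka_pow_add, pw, pw, pw, R.pair2, if_pos hc, h1 p a hp, h1 p' a' hp'] at h2
    simp at h2
  · rintro ⟨h1, h2⟩
    apply R.crit
    · rintro g ⟨p, a, hp, rfl⟩
      rw [pw]; exact h1 p a hp
    · rintro g ⟨p, a, hp, rfl⟩ g' ⟨p', a', hp', rfl⟩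
      rw [pw, R.pair2, if_neg (h2 p a p' a' hp hp')]

/-- transfer of h -/
theorem Fr.h_eq {F' W' : Type*} [Field F'] [CharP F' 2] [AddCommGroup W'] [Module F' W']
    [FiniteDimensional F' W'] {D' : FS F' W'} {x' : Fin r × Bool → W'} (R : D.Fr lam x)
    (R' : D'.Fr lam x')
    (hka : ∀ p a, D.ka ((D.T ^ p) (x a)) = 0 ↔ D'.ka ((D'.T ^ p) (x' a)) = 0) (m : ℕ) :
    D.h m = D'.h m := by
  unfold FS.h
  congr 1
  ext j
  simp only [Set.mem_ofPred_eq]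
  rw [R.crit_iff, R'.crit_iff]
  simp only [hka]

theorem Fr.finrank_ker (R : D.Fr lam x) (m : ℕ) :
    finrank F (LinearMap.ker (D.T ^ m)) = ∑ i, 2 * min m (lam i) := by
  classical
  let P : PF.Ix lam → Prop := fun u => lam u.1.1 ≤ m + u.2
  have h1 : LinearIndependent F (fun u : {u // P u} => PF.X D x u.1) :=
    R.linInd.comp _ Subtype.val_injective
  have h2 : LinearMap.ker (D.T ^ m) =
      Submodule.span F (Set.range (fun u : {u // P u} => PF.X D x u.1)) := by
    apply le_antisymm
    · intro w hw
      refine Submodule.span_le.2 ?_ (R.ker_le m hw)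
      rintro g ⟨p, a, hp, rfl⟩
      by_cases hp2 : p < lam a.1
      · exact Submodule.subset_span ⟨⟨⟨a, ⟨p, hp2⟩⟩, hp⟩, rfl⟩
      · rw [R.kill_le (by omega)]; exact Submodule.zero_mem _
    · rw [Submodule.span_le]
      rintro _ ⟨⟨u, hu⟩, rfl⟩
      simp only [SetLike.mem_coe, LinearMap.mem_ker, PF.X]
      rw [pw]; exact R.kill_le hu
  rw [h2, finrank_span_eq_card h1, Fintype.card_subtype, Finset.card_filter, Fintype.sum_sigma,
    Fintype.sum_prod_type]
  refine Finset.sum_congr rfl fun i _ => ?_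
  have : ∀ s : Bool, (∑ p : Fin (lam i), if P ⟨(i, s), p⟩ then 1 else 0) = min m (lam i) := by
    intro s
    rw [Fin.sum_univ_eq_sum_range (fun p => if lam i ≤ m + p then 1 else 0) (lam i)]
    rw [← Finset.card_filter]
    have : (Finset.range (lam i)).filter (fun p => lam i ≤ m + p) = Finset.Ico (lam i - m) (lam i) := by
      ext p; simp; omega
    rw [this, Nat.card_Ico]; omega
  simp only [this, Fintype.sum_bool]
  omega

end FS

theorem sum_min_succ {ι : Type*} (s : Finset ι) (lam : ι → ℕ) (m : ℕ) :
    ∑ i ∈ s, min (m + 1) (lam i) = ∑ i ∈ s, min m (lam i) + #{i ∈ s | m + 1 ≤ lam i} := by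
  rw [Finset.card_filter, ← Finset.sum_add_distrib]
  refine Finset.sum_congr rfl fun i _ => ?_
  split_ifs <;> omega

theorem antitone_le_iff {r : ℕ} {lam : Fin r → ℕ} (h : Antitone lam) (m : ℕ) (i : Fin r) :
    m ≤ lam i ↔ (i : ℕ) < #{i | m ≤ lam i} := by
  constructor
  · intro hm
    have : Finset.Iic i ⊆ ({i | m ≤ lam i} : Finset (Fin r)) := by
      intro j hj
      simp only [Finset.mem_Iic] at hj
      simp only [Finset.mem_filter, Finset.mem_univ, true_and]
      exact hm.trans (h hj)
    have := Finset.card_le_card this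
    rw [Fin.card_Iic] at this
    omega
  · intro hi
    by_contra hcon
    have : ({i | m ≤ lam i} : Finset (Fin r)) ⊆ Finset.Iio i := by
      intro j hj
      simp only [Finset.mem_filter, Finset.mem_univ, true_and] at hj
      simp only [Finset.mem_Iio]
      by_contra hji
      exact hcon (hj.trans (h (not_lt.1 hji)))
    have := Finset.card_le_card this
    rw [Fin.card_Iio] at this
    omega

theorem lam_unique {r r' : ℕ} {lam : Fin r → ℕ} {lam' : Fin r' → ℕ} (h : Antitone lam)
    (h' : Antitone lam') (hp : ∀ i, 1 ≤ lam i) (hp' : ∀ i, 1 ≤ lam' i)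
    (hs : ∀ m, ∑ i, 2 * min m (lam i) = ∑ i, 2 * min m (lam' i)) :
    ∃ e : r = r', ∀ i, lam i = lam' (Fin.cast e i) := by
  have hc : ∀ m, #{i | m + 1 ≤ lam i} = #{i | m + 1 ≤ lam' i} := by
    intro m
    have h1 := hs m
    have h2 := hs (m + 1)
    simp only [← Finset.mul_sum] at h1 h2
    rw [sum_min_succ, sum_min_succ] at h2
    omega
  have hr : r = r' := by
    have h0 := hc 0
    have e1 : ({i | 0 + 1 ≤ lam i} : Finset (Fin r)) = Finset.univ := by
      ext i; simpa using hp i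
    have e2 : ({i | 0 + 1 ≤ lam' i} : Finset (Fin r')) = Finset.univ := by
      ext i; simpa using hp' i
    rw [e1, e2] at h0
    simpa using h0
  subst hr
  refine ⟨rfl, fun i => ?_⟩
  have key : ∀ m, m ≤ lam i ↔ m ≤ lam' i := by
    intro m
    cases m with
    | zero => simp
    | succ m => rw [antitone_le_iff h, antitone_le_iff h', hc]
  exact le_antisymm ((key _).1 le_rfl) ((key _).2 le_rfl)

namespace FS

variable {F W : Type*} [Field F] [CharP F 2] [AddCommGroup W] [Module F W]
variable {D : FS F W} {r : ℕ} {lam h : Fin r → ℕ} {x : Fin r × Bool → W} {dl : Fin r → F}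
variable [FiniteDimensional F W]

/-- twisting the function ka -/
structure Shift (D D' : FS F W) (h : Fin r → ℕ) (x : Fin r × Bool → W) (ep : Fin r → F) : Prop where
  B : D'.B = D.B
  T : D'.T = D.T
  ka : ∀ w, D'.ka w = D.ka w + ∑ b, ep b * D.B ((D.T ^ (h b + 1)) (x (b, true))) w ^ 2

theorem NF.shift {D' : FS F W} {ep : Fin r → F} (N : NF D lam h x dl) (hS : Shift D D' h x ep)
    (hep : ∀ i, lam i = 2 * h i + 2 → ep i = 0) : NF D' lam h x (fun i => dl i + ep i) := by
  classical
  have hval : ∀ p i s, D'.ka ((D'.T ^ p) (x (i, s))) = D.ka ((D.T ^ p) (x (i, s))) +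
      if s = false ∧ p + 2 + h i = lam i then ep i else 0 := by
    intro p i s
    rw [hS.ka, hS.T]
    congr 1
    rw [Finset.sum_eq_single i]
    · rw [N.pair2]
      cases s
      · by_cases hp : p + 2 + h i = lam i
        · rw [if_pos ⟨rfl, by simp, by simp only; omega⟩, if_pos ⟨rfl, hp⟩]; simp
        · rw [if_neg, if_neg]
          · simp
          · rintro ⟨-, h⟩; exact hp h
          · rintro ⟨-, -, h⟩; simp only at h; omega
      · simp
    · intro b _ hb
      rw [N.pair2, if_neg]
      · simp
      · rintro ⟨h, -⟩; exact hb h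
    · simp
  refine ⟨⟨⟨N.pos, fun a => ?_, fun p a b => ?_⟩, N.dim⟩, fun i => ⟨fun hi p s => ?_, fun hi p => ?_,
    fun hi p => ?_⟩⟩
  · rw [hS.T, N.kill]
  · rw [hS.T, hS.B, N.pair]
  · rw [hval, (N.nfi i).1 hi, hep i hi]; simp
  · rw [hval, (N.nfi i).2.1 hi]; simp
  · rw [hval, (N.nfi i).2.2 hi]
    simp only [true_and]
    split_ifs <;> simp

end FS

/-- Nonvanishing of Gauss sums -/
theorem gauss_ne {F A : Type*} [Field F] [AddCommGroup A] [Module F A] [Fintype A]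
    (q : A → F) (β : A →ₗ[F] A →ₗ[F] F) (hq : ∀ v w, q (v + w) = q v + q w + β v w)
    (h2 : ∀ a : F, a + a = 0)
    (hrad : ∀ w, (∀ v, β v w = 0) → q w = 0) (ψ : F → ℤ) (h0 : ψ 0 = 1)
    (hψ : ∀ a b, ψ (a + b) = ψ a * ψ b) (hθ : ∃ θ, ψ θ ≠ 1) : ∑ v, ψ (q v) ≠ 0 := by
  classical
  intro hsum
  have h1 : (∑ v, ψ (q v)) * (∑ w, ψ (q w)) = ∑ w, ψ (q w) * ∑ v, ψ (β v w) := by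
    rw [Finset.sum_mul_sum]
    have : ∀ v, ∑ w, ψ (q v) * ψ (q w) = ∑ w, ψ (q w) * ψ (β v w) := by
      intro v
      rw [← Equiv.sum_comp (Equiv.addLeft v)]
      refine Finset.sum_congr rfl fun w _ => ?_
      rw [← hψ, ← hψ]
      congr 1
      simp only [Equiv.coe_addLeft, hq]
      linear_combination h2 (q v)
    simp only [this]
    rw [Finset.sum_comm]
    simp only [Finset.mul_sum]
  have h3 : ∀ w, ψ (q w) * ∑ v, ψ (β v w) = if ∀ v, β v w = 0 then (Fintype.card A : ℤ) else 0 := by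
    intro w
    split_ifs with hw
    · simp [hw, hrad w hw, h0]
    · push Not at hw
      obtain ⟨v0, hv0⟩ := hw
      obtain ⟨θ, hθ⟩ := hθ
      have : ∑ v, ψ (β v w) = ψ θ * ∑ v, ψ (β v w) := by
        conv_lhs => rw [← Equiv.sum_comp (Equiv.addLeft ((θ * (β v0 w)⁻¹) • v0))]
        rw [Finset.mul_sum]
        refine Finset.sum_congr rfl fun v _ => ?_
        simp only [Equiv.coe_addLeft, map_add, LinearMap.add_apply, hψ, map_smul,
          LinearMap.smul_apply, smul_eq_mul]
        rw [mul_assoc, inv_mul_cancel₀ hv0, mul_one]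
      have h4 : (ψ θ - 1) * ∑ v, ψ (β v w) = 0 := by linear_combination -this
      rcases mul_eq_zero.1 h4 with h5 | h5
      · exact absurd (by linarith) hθ
      · rw [h5, mul_zero]
  rw [hsum, zero_mul] at h1
  simp only [h3] at h1
  have h4 : (0 : ℤ) < ∑ w : A, if ∀ v, β v w = 0 then (Fintype.card A : ℤ) else 0 := by
    apply Finset.sum_pos'
    · intro w _; split_ifs <;> positivity
    · refine ⟨0, Finset.mem_univ _, ?_⟩
      simp only [map_zero, implies_true, if_true]
      exact_mod_cast Fintype.card_pos
  omega

theorem gauss_translate {F A : Type*} [Field F] [AddCommGroup A] [Module F A] [Fintype A]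
    (q : A → F) (β : A →ₗ[F] A →ₗ[F] F) (hq : ∀ v w, q (v + w) = q v + q w + β v w)
    (h2 : ∀ a : F, a + a = 0)
    (ψ : F → ℤ) (hψ : ∀ a b, ψ (a + b) = ψ a * ψ b) (hsq : ∀ a, ψ (a ^ 2) = ψ a)
    (z : A) : ∑ v, ψ (q v + β v z ^ 2) = ψ (q z) * ∑ v, ψ (q v) := by
  rw [← Equiv.sum_comp (Equiv.addRight z) (fun v => ψ (q v)), Finset.mul_sum]
  refine Finset.sum_congr rfl fun v _ => ?_
  simp only [Equiv.coe_addRight, hq]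
  rw [hψ, hsq, ← hψ, ← hψ]
  congr 1
  linear_combination -h2 (q z)

namespace FS

variable {F W : Type*} [Field F] [CharP F 2] [AddCommGroup W] [Module F W]
variable {D : FS F W} {r : ℕ} {lam h : Fin r → ℕ} {x : Fin r × Bool → W} {dl : Fin r → F}
variable [FiniteDimensional F W]

/-- numeric facts on (lam, h) -/
structure Num (lam h : Fin r → ℕ) : Prop where
  le : ∀ i, lam i ≤ 2 * h i + 2
  lip : ∀ i j, i ≤ j → h i ≤ h j + (lam i - lam j)
  mono : ∀ i j, i ≤ j → h j ≤ h i
  anti : Antitone lam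

theorem Fr.num (R : D.Fr lam x) (ha : Antitone lam) : Num lam (fun i => D.h (lam i)) :=
  ⟨R.lam_le, fun _ _ hij => D.h_lip (ha hij), fun _ _ hij => D.h_mono (ha hij), ha⟩

theorem Num.next (hN : Num lam h) {b i : Fin r} (hbi : b < i) : h i ≤ hn h b := by
  unfold hn
  have : (b : ℕ) + 1 < r := by have := i.2; have : (b : ℕ) < i := hbi; omega
  rw [dif_pos this]
  exact hN.mono _ _ (by rw [Fin.le_def]; simp only; have : (b : ℕ) < i := hbi; omega)

theorem NF.sep {D' : FS F W} {ep : Fin r → F} (N : NF D lam h x dl) (hN : Num lam h)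
    (hS : Shift D D' h x ep) (hep : ∀ i, ¬ Bk lam h i → ep i = 0) (b : Fin r) (hb : Bk lam h b)
    (hmin : ∀ i, i < b → ep i = 0) (ψ : F → ℤ) (h0 : ψ 0 = 1)
    (hψ : ∀ a b, ψ (a + b) = ψ a * ψ b) (hψsq : ∀ a, ψ (a ^ 2) = ψ a) (hθ : ψ (ep b) ≠ 1)
    (hsq : ∀ a : F, ∃ b, b ^ 2 = a)
    {A : Type*} [AddCommGroup A] [Module F A] [Fintype A] (π : A →ₗ[F] W)
    (hπ : Function.Surjective π) :
    ∃ j, ∑ v, ψ (D'.ka ((D'.T ^ j) (π v))) ≠ ∑ v, ψ (D.ka ((D.T ^ j) (π v))) := by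
  classical
  obtain ⟨j, hj⟩ : ∃ j, j + 2 + h b = lam b := ⟨lam b - 2 - h b, by have := hb.1; omega⟩
  have hlt : ∀ i, i ≤ b → j + 2 + h i ≤ lam i := by
    intro i hi
    have := hN.lip i b hi
    have := hN.anti hi
    omega
  have hgt : ∀ i, b < i → h i ≤ j := by
    intro i hi
    have := hN.next hi
    have := hb.1
    omega
  refine ⟨j, ?_⟩
  let q : A → F := fun v => D.ka ((D.T ^ j) (π v))
  let β : A →ₗ[F] A →ₗ[F] F := (D.B ∘ₗ (D.T ^ (2 * j + 2))).compl₁₂ π π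
  have hβ : ∀ v w, β v w = D.B ((D.T ^ (2 * j + 2)) (π v)) (π w) := fun v w => rfl
  have hq : ∀ v w, q (v + w) = q v + q w + β v w := by
    intro v w
    simp only [q]
    rw [map_add, D.ka_pow_add]; rfl
  have hH : D.H (2 * j + 2) j := by
    rw [N.toFr.crit_iff]
    refine ⟨fun p a hp => ?_, fun p a p' a' hp hp' hc => ?_⟩
    · obtain ⟨i, s⟩ := a
      simp only at hp
      by_cases hi : lam i = 2 * h i + 2
      · exact (N.nfi i).1 hi _ _
      have := hN.le i
      rcases le_or_gt i b with hib | hib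
      · have := hlt i hib
        cases s
        · rw [(N.nfi i).2.2 hi, if_neg (by omega)]
        · rw [(N.nfi i).2.1 hi, if_neg (by omega)]
      · have := hgt i hib
        cases s
        · rw [(N.nfi i).2.2 hi, if_neg (by omega)]
        · rw [(N.nfi i).2.1 hi, if_neg (by omega)]
    · have := hc.2.2; omega
  have hrad : ∀ w, (∀ v, β v w = 0) → q w = 0 := by
    intro w hw
    apply hH
    apply D.nd
    intro u
    obtain ⟨v, rfl⟩ := hπ u
    rw [D.adj_pow, D.symm]
    exact hw v
  have hne := gauss_ne q β hq add_self_F hrad ψ h0 hψ ⟨_, hθ⟩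
  obtain ⟨η, hη⟩ := hsq (ep b)
  have hlb := hN.le b
  have hb2 := hb.2
  obtain ⟨k, hk⟩ : ∃ k, k + 1 + j = h b := ⟨h b - 1 - j, by omega⟩
  obtain ⟨z, hz⟩ := hπ (η • (D.T ^ k) (x (b, true)))
  have ht := gauss_translate q β hq add_self_F ψ hψ hψsq z
  have hqz : q z = ep b := by
    simp only [q]
    rw [hz, D.ka_pow_smul, pw, (N.nfi b).2.1 hb2, if_pos (by omega), hη, mul_one]
  have hval : ∀ v, D'.ka ((D'.T ^ j) (π v)) = q v + β v z ^ 2 := by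
    intro v
    rw [hS.ka, hS.T]
    congr 1
    rw [Finset.sum_eq_single b]
    · have e : D.B ((D.T ^ (2 * j + 2)) (π v)) ((D.T ^ k) (x (b, true))) =
          D.B ((D.T ^ (h b + 1)) (x (b, true))) ((D.T ^ j) (π v)) := by
        have e2 : 2 * j + 2 + k = h b + 1 + j := by omega
        rw [D.adj2, D.adj_pow, D.symm, D.adj2, e2]
      rw [hβ, hz, map_smul, e, smul_eq_mul, mul_pow, hη]
    · intro i _ hib
      rcases lt_or_gt_of_ne hib with hlt | hgt'
      · rw [hmin i hlt, zero_mul]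
      · by_cases hbi : Bk lam h i
        · have h1 := hbi.2
          have h2 := hN.le i
          have h3 := hgt i hgt'
          rw [D.adj2, N.kill_le (by simp only; omega)]
          simp
        · rw [hep i hbi, zero_mul]
    · simp
  simp only [hval]
  rw [ht, hqz]
  intro hcon
  have : (ψ (ep b) - 1) * ∑ v, ψ (q v) = 0 := by
    have : ψ (ep b) * ∑ v, ψ (q v) = ∑ v, ψ (q v) := hcon
    linear_combination this
  rcases mul_eq_zero.1 this with h5 | h5
  · exact hθ (by linarith)
  · exact hne h5

end FS

/-- an odd orthogonal space with a nilpotent operator -/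
structure OS {F V : Type*} [Field F] [AddCommGroup V] [Module F V] (Q : QuadraticForm F V)
    (T : Module.End F V) (r : V) : Prop where
  rad : ∀ w, QuadraticMap.polar Q r w = 0
  Qr : Q r = 1
  nd : ∀ v, (∀ w, QuadraticMap.polar Q v w = 0) → ∃ c : F, v = c • r
  Tr : T r = 0
  altT : ∀ v, QuadraticMap.polar Q (T v) v = 0
  nil : IsNilpotent T

namespace OS

variable {F V : Type*} [Field F] [CharP F 2] [AddCommGroup V] [Module F V] {Q : QuadraticForm F V}
variable {T S : Module.End F V} {r : V}

variable (F r) in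
/-- the quotient by the radical -/
abbrev Wq := V ⧸ (Submodule.span F {r})

variable (F r) in
abbrev mq : V →ₗ[F] Wq F r := (Submodule.span F {r}).mkQ

variable (F r) in
noncomputable def sec : Wq F r →ₗ[F] V :=
  Classical.choose (LinearMap.exists_rightInverse_of_surjective (mq F r)
    (LinearMap.range_eq_top.2 (Submodule.mkQ_surjective _)))

variable (F r) in
theorem mk_sec (w : Wq F r) : mq F r (sec F r w) = w := by
  have := Classical.choose_spec (LinearMap.exists_rightInverse_of_surjective (mq F r)
    (LinearMap.range_eq_top.2 (Submodule.mkQ_surjective _)))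
  exact congrArg (fun f => f w) this

theorem mk_eq_iff {v w : V} : mq F r v = mq F r w ↔ ∃ c : F, v = w + c • r := by
  rw [← sub_eq_zero, ← map_sub]
  simp only [Submodule.mkQ_apply, Submodule.Quotient.mk_eq_zero, Submodule.mem_span_singleton]
  constructor
  · rintro ⟨c, hc⟩; exact ⟨c, by rw [hc]; abel⟩
  · rintro ⟨c, hc⟩; exact ⟨c, by rw [hc]; abel⟩

variable (F r) in
theorem sec_mk (v : V) : ∃ c : F, sec F r (mq F r v) = v + c • r := by
  rw [← mk_eq_iff, mk_sec]

theorem Q_add (v w : V) : Q (v + w) = Q v + Q w + QuadraticMap.polar Q v w :=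
  QuadraticMap.map_add Q v w

theorem Q_smul (c : F) (v : V) : Q (c • v) = c ^ 2 * Q v := by
  rw [QuadraticMap.map_smul, smul_eq_mul, pow_two]

variable (O : OS Q T r)
include O

theorem rad' (w : V) : QuadraticMap.polar Q w r = 0 := by
  rw [QuadraticMap.polar_comm, O.rad]

theorem polar_r (v w : V) (c d : F) :
    QuadraticMap.polar Q (v + c • r) (w + d • r) = QuadraticMap.polar Q v w := by
  simp only [QuadraticMap.polar_add_left, QuadraticMap.polar_add_right, QuadraticMap.polar_smul_left,
    QuadraticMap.polar_smul_right, O.rad, O.rad', smul_zero, add_zero]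

theorem Q_add_r (v : V) (c : F) : Q (v + c • r) = Q v + c ^ 2 := by
  rw [Q_add, Q_smul, O.Qr, QuadraticMap.polar_smul_right, O.rad']; simp

/-- the associated structure -/
noncomputable def fs : FS F (Wq F r) where
  B := (QuadraticMap.polarBilin Q).compl₁₂ (sec F r) (sec F r)
  T := mq F r ∘ₗ T ∘ₗ sec F r
  ka w := Q (T (sec F r w))
  alt w := by
    simp only [LinearMap.compl₁₂_apply, QuadraticMap.polarBilin_apply_apply]
    rw [QuadraticMap.polar_self, two_nsmul]; exact CharTwo.add_self_eq_zero _
  nd w hw := by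
    simp only [LinearMap.compl₁₂_apply, QuadraticMap.polarBilin_apply_apply] at hw
    obtain ⟨c, hc⟩ := O.nd (sec F r w) (fun u => by
      have := hw (mq F r u)
      obtain ⟨d, hd⟩ := sec_mk F r u
      rw [hd] at this
      have h2 := O.polar_r (sec F r w) u 0 d
      rw [zero_smul, add_zero] at h2
      rw [← h2, this])
    rw [← mk_sec F r w, hc, map_smul]
    have : mq F r r = mq F r 0 := mk_eq_iff.2 ⟨1, by simp⟩
    rw [this, map_zero, smul_zero]
  altT w := by
    simp only [LinearMap.compl₁₂_apply, QuadraticMap.polarBilin_apply_apply, LinearMap.comp_apply]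
    obtain ⟨d, hd⟩ := sec_mk F r (T (sec F r w))
    rw [hd]
    have h2 := O.polar_r (T (sec F r w)) (sec F r w) d 0
    rw [zero_smul, add_zero] at h2
    rw [h2, O.altT]
  nil := by
    obtain ⟨n, hn⟩ := O.nil
    have : ∀ k v, ((mq F r ∘ₗ T ∘ₗ sec F r) ^ k) (mq F r v) = mq F r ((T ^ k) v) := by
      intro k
      induction k with
      | zero => intro v; rfl
      | succ k ih =>
        intro v
        rw [pow_succ, Module.End.mul_apply, pow_succ, Module.End.mul_apply, ← ih]
        congr 1
        simp only [LinearMap.comp_apply]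
        obtain ⟨d, hd⟩ := sec_mk F r v
        rw [hd, map_add, map_smul, O.Tr]; simp
    refine ⟨n, LinearMap.ext fun w => ?_⟩
    rw [← mk_sec F r w, this, hn]; simp
  ka_smul c w := by rw [map_smul, map_smul, Q_smul]
  ka_add v w := by
    rw [map_add, map_add, Q_add]
    congr 1
    simp only [LinearMap.compl₁₂_apply, QuadraticMap.polarBilin_apply_apply, LinearMap.comp_apply]
    set a := sec F r v
    set b := sec F r w
    obtain ⟨d, hd⟩ := sec_mk F r (T a)
    rw [hd, map_add, map_smul, O.Tr]
    obtain ⟨e, he⟩ := sec_mk F r (T (T a))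
    rw [smul_zero, add_zero, he]
    have h2 := O.polar_r (T (T a)) b e 0
    rw [zero_smul, add_zero] at h2
    rw [h2]
    have h3 := O.altT (T a + b)
    simp only [map_add, QuadraticMap.polar_add_left, QuadraticMap.polar_add_right, O.altT] at h3
    rw [QuadraticMap.polar_comm Q (T a)]
    apply FS.eq_of_add_F
    linear_combination h3

theorem B_mk (v w : V) : O.fs.B (mq F r v) (mq F r w) = QuadraticMap.polar Q v w := by
  obtain ⟨c, hc⟩ := sec_mk F r v
  obtain ⟨d, hd⟩ := sec_mk F r w
  simp only [fs, LinearMap.compl₁₂_apply, QuadraticMap.polarBilin_apply_apply]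
  rw [hc, hd, O.polar_r]

theorem T_mk (v : V) : O.fs.T (mq F r v) = mq F r (T v) := by
  obtain ⟨c, hc⟩ := sec_mk F r v
  simp only [fs, LinearMap.comp_apply]
  rw [hc, map_add, map_smul, O.Tr]; simp

theorem ka_mk (v : V) : O.fs.ka (mq F r v) = Q (T v) := by
  obtain ⟨c, hc⟩ := sec_mk F r v
  simp only [fs]
  rw [hc, map_add, map_smul, O.Tr]; simp

theorem Tp_mk (p : ℕ) (v : V) : (O.fs.T ^ p) (mq F r v) = mq F r ((T ^ p) v) := by
  induction p generalizing v with
  | zero => rfl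
  | succ k ih =>
    rw [pow_succ, Module.End.mul_apply, pow_succ, Module.End.mul_apply, ← ih, O.T_mk]

theorem ka_Tp_mk (p : ℕ) (v : V) : O.fs.ka ((O.fs.T ^ p) (mq F r v)) = Q ((T ^ (p + 1)) v) := by
  rw [O.Tp_mk, O.ka_mk, pow_succ', Module.End.mul_apply]

theorem finrank_W [FiniteDimensional F V] : finrank F (Wq F r) + 1 = finrank F V := by
  have hr : r ≠ 0 := by
    rintro rfl
    have := O.Qr
    rw [QuadraticMap.map_zero] at this
    exact zero_ne_one this
  rw [← finrank_span_singleton (K := F) hr]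
  exact Submodule.finrank_quotient_add_finrank _

/-- lifting an isomorphism -/
theorem lift [FiniteDimensional F V] (hsq : ∀ a : F, ∃ b, b ^ 2 = a) (O' : OS Q S r)
    (g : Wq F r ≃ₗ[F] Wq F r) (hB : ∀ v w, O'.fs.B (g v) (g w) = O.fs.B v w)
    (hT : ∀ v, g (O.fs.T v) = O'.fs.T (g v)) (hka : ∀ v, O'.fs.ka (g v) = O.fs.ka v) :
    ∃ G : V ≃ₗ[F] V, (∀ v, Q (G v) = Q v) ∧ ∀ v, G (T v) = S (G v) := by
  have uniq : ∀ v w : V, mq F r v = mq F r w → Q v = Q w → v = w := by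
    intro v w h1 h2
    obtain ⟨c, rfl⟩ := mk_eq_iff.1 h1
    rw [O.Q_add_r] at h2
    have : c ^ 2 = 0 := by linear_combination h2
    rw [pow_eq_zero_iff (by norm_num)] at this
    simp [this]
  have ex : ∀ v : V, ∃ v', mq F r v' = g (mq F r v) ∧ Q v' = Q v := by
    intro v
    set v0 := sec F r (g (mq F r v))
    obtain ⟨c, hc⟩ := hsq (Q v + Q v0)
    refine ⟨v0 + c • r, ?_, ?_⟩
    · rw [mk_eq_iff.2 ⟨c, rfl⟩, mk_sec]
    · rw [O.Q_add_r, hc]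
      linear_combination FS.add_self_F (Q v0)
  choose G hG1 hG2 using ex
  let G' : V →ₗ[F] V :=
    { toFun := G
      map_add' := fun v w => by
        apply uniq
        · rw [hG1, map_add, map_add, map_add, hG1, hG1]
        · rw [hG2, Q_add, Q_add, hG2, hG2, ← O.B_mk, ← O'.B_mk, hG1, hG1, hB]
      map_smul' := fun c v => by
        simp only [RingHom.id_apply]
        apply uniq
        · rw [hG1, map_smul, map_smul, map_smul, hG1]
        · rw [hG2, Q_smul, Q_smul, hG2] }
  have hinj : Function.Injective G' := by
    rw [← LinearMap.ker_eq_bot, LinearMap.ker_eq_bot']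
    intro v hv
    have h1 : G v = 0 := hv
    apply uniq
    · have := hG1 v
      rw [h1, map_zero] at this
      rw [map_zero]
      exact (g.map_eq_zero_iff.1 this.symm)
    · rw [← hG2, h1]
  refine ⟨LinearEquiv.ofInjectiveEndo G' hinj, fun v => ?_, fun v => ?_⟩
  · exact hG2 v
  · change G (T v) = S (G v)
    apply uniq
    · rw [hG1, ← O.T_mk, hT, ← hG1, O'.T_mk]
    · rw [hG2, ← O.ka_mk, ← hka, ← hG1, O'.ka_mk]

theorem oconj [FiniteDimensional F V] (hsq : ∀ a : F, ∃ b, b ^ 2 = a) (O' : OS Q S r)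
    (g : Wq F r ≃ₗ[F] Wq F r) (hB : ∀ v w, O'.fs.B (g v) (g w) = O.fs.B v w)
    (hT : ∀ v, g (O.fs.T v) = O'.fs.T (g v)) (hka : ∀ v, O'.fs.ka (g v) = O.fs.ka v) :
    Q.OConj T S := by
  obtain ⟨G, h1, h2⟩ := O.lift hsq O' g hB hT hka
  refine ⟨G, h1, LinearMap.ext fun v => ?_⟩
  simp [h2]

end OS

/-- twisted operator -/
noncomputable def twist {F V : Type*} [Field F] [AddCommGroup V] [Module F V] (Q : QuadraticForm F V)
    (T : Module.End F V) (r : V) {m : ℕ} (η : Fin m → F) (u : Fin m → V) : Module.End F V :=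
  T + (∑ b, η b • QuadraticMap.polarBilin Q (u b)).smulRight r

theorem twist_apply {F V : Type*} [Field F] [AddCommGroup V] [Module F V] (Q : QuadraticForm F V)
    (T : Module.End F V) (r : V) {m : ℕ} (η : Fin m → F) (u : Fin m → V) (v : V) :
    twist Q T r η u v = T v + (∑ b, η b * QuadraticMap.polar Q (u b) v) • r := by
  simp [twist]

namespace OS
variable {F V : Type*} [Field F] [CharP F 2] [AddCommGroup V] [Module F V] {Q : QuadraticForm F V}
variable {T S : Module.End F V} {r : V} (O : OS Q T r)
include O

theorem twist {m : ℕ} (η : Fin m → F) (u : Fin m → V) : OS Q (twist Q T r η u) r where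
  rad := O.rad
  Qr := O.Qr
  nd := O.nd
  Tr := by
    rw [twist_apply, O.Tr]
    simp [O.rad']
  altT v := by
    rw [twist_apply, QuadraticMap.polar_add_left, QuadraticMap.polar_smul_left, O.altT, O.rad]
    simp
  nil := by
    obtain ⟨n, hn⟩ := O.nil
    set S := _root_.twist Q T r η u with hS
    have hSr : S r = 0 := by
      rw [hS, twist_apply, O.Tr]
      simp [O.rad']
    have h1 : ∀ k v, mq F r ((S ^ k) v) = mq F r ((T ^ k) v) := by
      intro k
      induction k with
      | zero => intro v; rfl
      | succ k ih =>
        intro v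
        rw [pow_succ', Module.End.mul_apply, pow_succ', Module.End.mul_apply, ← O.T_mk ((T ^ k) v),
          ← ih, O.T_mk, mk_eq_iff, hS, twist_apply]
        exact ⟨_, rfl⟩
    refine ⟨n + 1, LinearMap.ext fun v => ?_⟩
    have h2 := h1 n v
    rw [hn, LinearMap.zero_apply, mk_eq_iff] at h2
    obtain ⟨c, hc⟩ := h2
    rw [pow_succ', Module.End.mul_apply, hc]
    simp [hSr]

theorem twist_shift {m : ℕ} (η : Fin m → F) (h : Fin m → ℕ) (e : Fin m → V) (x : Fin m × Bool → Wq F r)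
    (hx : ∀ b, x (b, true) = mq F r (e b)) :
    FS.Shift O.fs (O.twist η (fun b => (T ^ (h b + 1)) (e b))).fs h x (fun b => η b ^ 2) where
  B := by
    refine LinearMap.ext fun v => LinearMap.ext fun w => ?_
    rw [← mk_sec F r v, ← mk_sec F r w, O.B_mk, OS.B_mk]
  T := by
    refine LinearMap.ext fun v => ?_
    rw [← mk_sec F r v, O.T_mk, OS.T_mk, mk_eq_iff, twist_apply]
    exact ⟨_, rfl⟩
  ka w := by
    rw [← mk_sec F r w, O.ka_mk, OS.ka_mk, twist_apply, O.Q_add_r, CharTwo.sum_sq]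
    congr 1
    refine Finset.sum_congr rfl fun b _ => ?_
    rw [mul_pow, hx, O.Tp_mk, O.B_mk]

end OS

theorem OS.exists_of {F V : Type*} [Field F] [CharP F 2] [AddCommGroup V] [Module F V]
    [FiniteDimensional F V] (hsq : ∀ a : F, ∃ b, b ^ 2 = a) {n : ℕ} (Q : QuadraticForm F V)
    (hdim : finrank F V = 2 * n + 1) (hQ : Q.IsNondegenerateFormSpace) :
    ∃ r : V, ∀ T, Q.mem_oLie T → IsNilpotent T → OS Q T r := by
  obtain ⟨-, h1, h2⟩ := hQ
  have hmem : ∀ v, v ∈ Q.polarRadical ↔ ∀ w, QuadraticMap.polar Q v w = 0 := by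
    intro v
    rw [QuadraticForm.polarRadical, LinearMap.mem_ker]
    constructor
    · intro h w
      rw [← QuadraticMap.polarBilin_apply_apply, h, LinearMap.zero_apply]
    · intro h
      refine LinearMap.ext fun w => ?_
      rw [QuadraticMap.polarBilin_apply_apply, h, LinearMap.zero_apply]
  have hne : ∃ r0, r0 ∈ Q.polarRadical ∧ r0 ≠ 0 := by
    by_contra hcon
    push Not at hcon
    let D : FS F V :=
      { B := QuadraticMap.polarBilin Q
        T := 0
        ka := fun _ => 0
        alt := fun w => by
          rw [QuadraticMap.polarBilin_apply_apply, QuadraticMap.polar_self, two_nsmul]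
          exact CharTwo.add_self_eq_zero _
        nd := fun w hw => hcon w ((hmem w).2 hw)
        altT := fun w => by simp
        nil := IsNilpotent.zero
        ka_smul := fun c w => by simp
        ka_add := fun v w => by simp }
    obtain ⟨r, lam, x, R, -⟩ := D.exists_frame
    have := R.dim
    rw [← Finset.mul_sum] at this
    omega
  obtain ⟨r0, hr0, hr0'⟩ := hne
  have hgen : ∀ v ∈ Q.polarRadical, ∃ c : F, v = c • r0 := by
    intro v hv
    have hone := (finrank_le_one_iff (K := F) (V := Q.polarRadical)).1 h1
    obtain ⟨g, hg⟩ := hone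
    obtain ⟨a, ha⟩ := hg ⟨r0, hr0⟩
    obtain ⟨b, hb⟩ := hg ⟨v, hv⟩
    have ha' : a • (g : V) = r0 := congrArg Subtype.val ha
    have hb' : b • (g : V) = v := congrArg Subtype.val hb
    have ha0 : a ≠ 0 := by rintro rfl; rw [zero_smul] at ha'; exact hr0' ha'.symm
    refine ⟨b * a⁻¹, ?_⟩
    rw [← hb', ← ha', smul_smul, mul_assoc, inv_mul_cancel₀ ha0, mul_one]
  obtain ⟨c, hc⟩ := hsq (Q r0)⁻¹
  have hQ0 := h2 r0 hr0 hr0'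
  have hc0 : c ≠ 0 := by
    rintro rfl
    rw [zero_pow two_ne_zero] at hc
    exact inv_ne_zero hQ0 hc.symm
  have hnd : ∀ v, (∀ w, QuadraticMap.polar Q v w = 0) → ∃ d : F, v = d • (c • r0) := by
    intro v hv
    obtain ⟨d, rfl⟩ := hgen v ((hmem v).2 hv)
    exact ⟨d * c⁻¹, by rw [smul_smul, mul_assoc, inv_mul_cancel₀ hc0, mul_one]⟩
  have hrad : ∀ w, QuadraticMap.polar Q (c • r0) w = 0 :=
    (hmem _).1 (Submodule.smul_mem _ _ hr0)
  refine ⟨c • r0, fun T hT hTn => ⟨hrad, ?_, hnd, ?_, hT.1, hTn⟩⟩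
  · rw [OS.Q_smul, hc, inv_mul_cancel₀ hQ0]
  · obtain ⟨d, hd⟩ := hnd (T (c • r0)) (fun w => by
      have h3 := hT.1 (c • r0 + w)
      simp only [map_add, QuadraticMap.polar_add_left, QuadraticMap.polar_add_right, hT.1] at h3
      have h4 := hrad (T w)
      rw [QuadraticMap.polar_comm] at h4
      rw [h4] at h3
      simpa using h3)
    have hpow : ∀ k, (T ^ k) (c • r0) = d ^ k • (c • r0) := by
      intro k
      induction k with
      | zero => simp
      | succ k ih => rw [pow_succ', Module.End.mul_apply, ih, map_smul, hd, smul_smul, pow_succ]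
    obtain ⟨k, hk⟩ := hTn
    have h5 := hpow k
    rw [hk, LinearMap.zero_apply] at h5
    have h6 : d ^ k = 0 := (smul_eq_zero.1 h5.symm).resolve_right (smul_ne_zero hc0 hr0')
    have h7 : d = 0 := eq_zero_of_pow_eq_zero h6
    rw [hd, h7, zero_smul]

/-- scalar extension data for the quadratic form -/
structure SE {F K V V' : Type*} [Field F] [Field K] [Algebra F K]
    [AddCommGroup V] [Module F V] [AddCommGroup V'] [Module K V']
    (Q : QuadraticForm F V) (Q' : QuadraticForm K V') (σ : V →ₛₗ[algebraMap F K] V') : Prop where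
  Qs : ∀ v, Q' (σ v) = algebraMap F K (Q v)
  span : Submodule.span K (Set.range σ) = ⊤
  dim : finrank K V' = finrank F V

namespace SE

variable {F K V V' : Type*} [Field F] [Field K] [Algebra F K]
  [AddCommGroup V] [Module F V] [AddCommGroup V'] [Module K V']
  {Q : QuadraticForm F V} {Q' : QuadraticForm K V'} {σ : V →ₛₗ[algebraMap F K] V'}

theorem of_basis (hQ : ∀ v : V, Q' (σ v) = algebraMap F K (Q v)) {n : ℕ} (b : Basis (Fin n) F V)
    (hli : LinearIndependent K (fun i => σ (b i)))
    (hsp : Submodule.span K (Set.range fun i => σ (b i)) = ⊤) : SE Q Q' σ := by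
  refine ⟨hQ, ?_, ?_⟩
  · rw [eq_top_iff, ← hsp]
    apply Submodule.span_mono
    rintro _ ⟨i, rfl⟩
    exact ⟨b i, rfl⟩
  · rw [finrank_eq_card_basis b, finrank_eq_card_basis (Basis.mk hli hsp.ge)]

variable (E : SE Q Q' σ)
include E

theorem polar (v w : V) :
    QuadraticMap.polar Q' (σ v) (σ w) = algebraMap F K (QuadraticMap.polar Q v w) := by
  simp only [QuadraticMap.polar, ← map_add, E.Qs, ← map_sub]

theorem ind {p : V' → Prop} (h0 : ∀ v, p (σ v)) (hadd : ∀ v w, p v → p w → p (v + w))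
    (hsmul : ∀ (c : K) v, p v → p (c • v)) (v : V') : p v := by
  have hv : v ∈ Submodule.span K (Set.range σ) := by rw [E.span]; trivial
  induction hv using Submodule.span_induction with
  | mem x hx => obtain ⟨u, rfl⟩ := hx; exact h0 u
  | zero => rw [← map_zero σ]; exact h0 0
  | add x y _ _ hx hy => exact hadd x y hx hy
  | smul c x _ hx => exact hsmul c x hx

theorem pow {T : Module.End F V} {T' : Module.End K V'} (hT : ∀ v, σ (T v) = T' (σ v)) (p : ℕ) (v : V) :
    σ ((T ^ p) v) = (T' ^ p) (σ v) := by
  induction p generalizing v with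
  | zero => rfl
  | succ p ih => rw [pow_succ, Module.End.mul_apply, ih, hT, pow_succ, Module.End.mul_apply]

theorem os [CharP F 2] [CharP K 2] [FiniteDimensional F V] {T : Module.End F V} {T' : Module.End K V'}
    {r : V} (O : OS Q T r)
    (hT : ∀ v, σ (T v) = T' (σ v)) : OS Q' T' (σ r) where
  rad := by
    refine E.ind ?_ ?_ ?_
    · intro v; rw [E.polar, O.rad, map_zero]
    · intro v w h1 h2; rw [QuadraticMap.polar_add_right, h1, h2, add_zero]
    · intro c v h; rw [QuadraticMap.polar_smul_right, h, smul_zero]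
  Qr := by rw [E.Qs, O.Qr, map_one]
  nd := by
    obtain ⟨m, lam, x, R, -⟩ := O.fs.exists_frame
    have key : ∀ v' : V', ∃ c : K, v' = c • σ r +
        ∑ u, QuadraticMap.polar Q' v' (σ (OS.sec F r (FS.PF.Y O.fs x u))) •
          σ (OS.sec F r (FS.PF.X (lam := lam) O.fs x u)) := by
      refine E.ind ?_ ?_ ?_
      · intro v
        have h1 : OS.mq F r v = OS.mq F r
            (∑ u, QuadraticMap.polar Q v (OS.sec F r (FS.PF.Y O.fs x u)) •
              (OS.sec F r (FS.PF.X (lam := lam) O.fs x u))) := by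
          rw [map_sum]
          simp only [map_smul]
          conv_lhs => rw [R.expand (OS.mq F r v)]
          refine Finset.sum_congr rfl fun u _ => ?_
          rw [OS.mk_sec, ← O.B_mk, OS.mk_sec]
        obtain ⟨c, hc⟩ := OS.mk_eq_iff.1 h1
        refine ⟨algebraMap F K c, ?_⟩
        conv_lhs => rw [hc, map_add, map_sum, LinearMap.map_smulₛₗ, add_comm]
        congr 1
        refine Finset.sum_congr rfl fun u _ => ?_
        rw [LinearMap.map_smulₛₗ, E.polar]
      · rintro v w ⟨c, hc⟩ ⟨d, hd⟩
        refine ⟨c + d, ?_⟩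
        conv_lhs => rw [hc, hd]
        simp only [QuadraticMap.polar_add_left, add_smul, Finset.sum_add_distrib]
        abel
      · rintro a v ⟨c, hc⟩
        refine ⟨a * c, ?_⟩
        conv_lhs => rw [hc]
        simp only [QuadraticMap.polar_smul_left, smul_add, Finset.smul_sum, smul_smul, smul_eq_mul]
    intro v hv
    obtain ⟨c, hc⟩ := key v
    refine ⟨c, ?_⟩
    simpa [hv] using hc
  Tr := by rw [← hT, O.Tr, map_zero]
  altT := by
    have h1 : ∀ v w, QuadraticMap.polar Q' (T' v) w + QuadraticMap.polar Q' (T' w) v = 0 := by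
      refine E.ind ?_ ?_ ?_
      · intro v
        refine E.ind ?_ ?_ ?_
        · intro w
          rw [← hT, ← hT, E.polar, E.polar, ← map_add]
          have h3 := O.altT (v + w)
          simp only [map_add, QuadraticMap.polar_add_left, QuadraticMap.polar_add_right, O.altT] at h3
          rw [show QuadraticMap.polar Q (T v) w + QuadraticMap.polar Q (T w) v = 0 by
            linear_combination h3, map_zero]
        · intro w u h h'
          simp only [map_add, QuadraticMap.polar_add_left, QuadraticMap.polar_add_right]
          linear_combination h + h'
        · intro c w h
          simp only [map_smul, QuadraticMap.polar_smul_left, QuadraticMap.polar_smul_right, smul_eq_mul]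
          linear_combination c * h
      · intro w u h h' v
        simp only [map_add, QuadraticMap.polar_add_left, QuadraticMap.polar_add_right]
        linear_combination h v + h' v
      · intro c w h v
        simp only [map_smul, QuadraticMap.polar_smul_left, QuadraticMap.polar_smul_right, smul_eq_mul]
        linear_combination c * h v
    refine E.ind ?_ ?_ ?_
    · intro v; rw [← hT, E.polar, O.altT, map_zero]
    · intro v w h h'
      simp only [map_add, QuadraticMap.polar_add_left, QuadraticMap.polar_add_right]
      linear_combination h + h' + h1 v w
    · intro c v h
      simp only [map_smul, QuadraticMap.polar_smul_left, QuadraticMap.polar_smul_right, smul_eq_mul, h]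
      simp
  nil := by
    obtain ⟨n, hn⟩ := O.nil
    refine ⟨n, LinearMap.ext ?_⟩
    refine E.ind ?_ ?_ ?_
    · intro v; rw [← E.pow hT, hn]; simp
    · intro v w h h'; rw [map_add, h, h']; simp
    · intro c v h; rw [map_smul, h]; simp

theorem frame [CharP F 2] [CharP K 2] [FiniteDimensional F V] [FiniteDimensional K V']
    {T : Module.End F V} {T' : Module.End K V'} {r : V} (O : OS Q T r)
    (hT : ∀ v, σ (T v) = T' (σ v)) (O' : OS Q' T' (σ r)) {m : ℕ} {lam : Fin m → ℕ}
    {x : Fin m × Bool → OS.Wq F r} (R : O.fs.Fr lam x) :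
    O'.fs.Fr lam (fun a => OS.mq K (σ r) (σ (OS.sec F r (x a)))) where
  pos := R.pos
  kill a := by
    have h := R.kill a
    rw [← OS.mk_sec F r (x a), O.Tp_mk, ← map_zero (OS.mq F r), OS.mk_eq_iff] at h
    obtain ⟨c, hc⟩ := h
    rw [O'.Tp_mk, ← E.pow hT, hc, ← map_zero (OS.mq K (σ r)), OS.mk_eq_iff]
    exact ⟨algebraMap F K c, by simp⟩
  pair p a b := by
    have h := R.pair p a b
    rw [← OS.mk_sec F r (x a), ← OS.mk_sec F r (x b), O.Tp_mk, O.B_mk] at h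
    rw [O'.Tp_mk, O'.B_mk, ← E.pow hT, E.polar, h]
    split_ifs <;> simp
  dim := by
    have h1 := O.finrank_W
    have h2 := O'.finrank_W
    have h3 := E.dim
    have h4 := R.dim
    omega

theorem ka [CharP F 2] [CharP K 2] {T : Module.End F V} {T' : Module.End K V'} {r : V} (O : OS Q T r)
    (hT : ∀ v, σ (T v) = T' (σ v)) (O' : OS Q' T' (σ r)) (p : ℕ) (w : OS.Wq F r) :
    O'.fs.ka ((O'.fs.T ^ p) (OS.mq K (σ r) (σ (OS.sec F r w)))) =
      algebraMap F K (O.fs.ka ((O.fs.T ^ p) w)) := by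
  rw [O'.ka_Tp_mk, ← E.pow hT, E.Qs, ← O.ka_Tp_mk, OS.mk_sec]

theorem h_eq [CharP F 2] [CharP K 2] [FiniteDimensional F V] [FiniteDimensional K V']
    {T : Module.End F V} {T' : Module.End K V'} {r : V} (O : OS Q T r)
    (hT : ∀ v, σ (T v) = T' (σ v)) (O' : OS Q' T' (σ r)) (m : ℕ) : O.fs.h m = O'.fs.h m := by
  obtain ⟨k, lam, x, R, -⟩ := O.fs.exists_frame
  refine R.h_eq (E.frame O hT O' R) (fun p a => ?_) m
  rw [E.ka O hT O']
  simp

theorem nf [CharP F 2] [CharP K 2] [FiniteDimensional F V] [FiniteDimensional K V']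
    {T : Module.End F V} {T' : Module.End K V'} {r : V} (O : OS Q T r)
    (hT : ∀ v, σ (T v) = T' (σ v)) (O' : OS Q' T' (σ r)) {m : ℕ} {lam h : Fin m → ℕ}
    {x : Fin m × Bool → OS.Wq F r} {dl : Fin m → F} (N : FS.NF O.fs lam h x dl) :
    FS.NF O'.fs lam h (fun a => OS.mq K (σ r) (σ (OS.sec F r (x a)))) (fun i => algebraMap F K (dl i)) where
  toFr := E.frame O hT O' N.toFr
  nfi i := by
    obtain ⟨h1, h2, h3⟩ := N.nfi i
    refine ⟨fun hl p s => ?_, fun hl p => ?_, fun hl p => ?_⟩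
    · rw [E.ka O hT O', h1 hl, map_zero]
    · rw [E.ka O hT O', h2 hl]; split_ifs <;> simp
    · rw [E.ka O hT O', h3 hl]; split_ifs <;> simp

end SE

theorem exists_psi (F : Type*) [Field F] [Finite F] [CharP F 2] :
    ∃ (ψ : F → ℤ) (θ : F), ψ 0 = 1 ∧ (∀ a b, ψ (a + b) = ψ a * ψ b) ∧ (∀ a, ψ (a ^ 2) = ψ a) ∧
      ψ θ = -1 ∧ (∀ a, ψ a = 1 ∨ ψ a = -1) ∧ ∀ a, ψ a = 1 → ∃ c, a = c ^ 2 + c := by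
  classical
  let f : F →+ F :=
    { toFun := fun a => a ^ 2 + a
      map_zero' := by simp
      map_add' := fun a b => by rw [CharTwo.add_sq]; ring }
  have hf : ∀ a, f a = a ^ 2 + a := fun a => rfl
  have hind : f.range.index = 2 := by
    have h1 : f.range.index * Nat.card f.range = Nat.card F := AddSubgroup.index_mul_card _
    have h2 : Nat.card f.ker * f.ker.index = Nat.card F := AddSubgroup.card_mul_index _
    have h3 : f.ker.index = Nat.card f.range := AddSubgroup.index_ker f
    have h4 : Nat.card f.ker = 2 := by
      have : (f.ker : Set F) = {0, 1} := by
        ext a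
        simp only [SetLike.mem_coe, AddMonoidHom.mem_ker, hf, Set.mem_insert_iff,
          Set.mem_singleton_iff]
        constructor
        · intro h
          have : a * (a + 1) = 0 := by linear_combination h
          rcases mul_eq_zero.1 this with h | h
          · exact Or.inl h
          · exact Or.inr (FS.eq_of_add_F h)
        · rintro (rfl | rfl)
          · simp
          · rw [one_pow]; exact FS.add_self_F 1
      have h5 : Nat.card f.ker = Set.ncard (f.ker : Set F) := rfl
      rw [h5, this, Set.ncard_pair zero_ne_one]
    have hpos : 0 < Nat.card f.range := Nat.card_pos
    rw [h3, h4] at h2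
    exact Nat.eq_of_mul_eq_mul_right hpos (h1.trans h2.symm)
  have hadd : ∀ a b, a + b ∈ f.range ↔ (a ∈ f.range ↔ b ∈ f.range) := fun a b =>
    AddSubgroup.add_mem_iff_of_index_two hind
  have hex : ∃ θ, θ ∉ f.range := by
    by_contra hcon
    push Not at hcon
    have : f.range = ⊤ := by rw [eq_top_iff]; intro a _; exact hcon a
    rw [this, AddSubgroup.index_top] at hind
    omega
  obtain ⟨θ, hθ⟩ := hex
  refine ⟨fun a => if a ∈ f.range then 1 else -1, θ, ?_, ?_, ?_, ?_, ?_, ?_⟩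
  · simp [f.range.zero_mem]
  · intro a b
    simp only [hadd]
    by_cases h1 : a ∈ f.range <;> by_cases h2 : b ∈ f.range <;> simp [h1, h2]
  · intro a
    have h1 : a ^ 2 + a ∈ f.range := ⟨a, rfl⟩
    rw [hadd] at h1
    simp only [h1]
  · simp [hθ]
  · intro a
    by_cases h1 : a ∈ f.range <;> simp [h1]
  · intro a ha
    by_cases h1 : a ∈ f.range
    · obtain ⟨c, hc⟩ := h1
      exact ⟨c, hc.symm⟩
    · simp [h1] at ha

theorem FS.Shift.trans {F W : Type*} [Field F] [CharP F 2] [AddCommGroup W] [Module F W] {r : ℕ}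
    {D D₁ D₂ : FS F W} {h : Fin r → ℕ} {x : Fin r × Bool → W} {e₁ e₂ : Fin r → F}
    (h₁ : FS.Shift D D₁ h x e₁) (h₂ : FS.Shift D D₂ h x e₂) :
    FS.Shift D₁ D₂ h x (fun b => e₁ b + e₂ b) where
  B := by rw [h₁.B, h₂.B]
  T := by rw [h₁.T, h₂.T]
  ka w := by
    rw [h₁.ka, h₂.ka, h₁.B, h₁.T]
    simp only [add_mul, Finset.sum_add_distrib]
    set A := ∑ b, e₁ b * D.B ((D.T ^ (h b + 1)) (x (b, true))) w ^ 2
    linear_combination -FS.add_self_F A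

theorem OS.mem_oLie {F V : Type*} [Field F] [AddCommGroup V] [Module F V] {Q : QuadraticForm F V}
    {T : Module.End F V} {r : V} (O : OS Q T r) : Q.mem_oLie T :=
  ⟨O.altT, (LinearMap.isNilpotent_trace_of_isNilpotent O.nil).eq_zero⟩

theorem OConj_sum {F V : Type*} [Field F] [AddCommGroup V] [Module F V] [Fintype V]
    {Q : QuadraticForm F V} {S T : Module.End F V} (h : Q.OConj S T) (ψ : F → ℤ) (j : ℕ) :
    ∑ v, ψ (Q ((S ^ j) v)) = ∑ v, ψ (Q ((T ^ j) v)) := by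
  obtain ⟨g, hg, rfl⟩ := h
  rw [← Equiv.sum_comp g.toEquiv (fun v => ψ (Q (((g.toLinearMap ∘ₗ S ∘ₗ g.symm.toLinearMap) ^ j) v)))]
  refine Finset.sum_congr rfl fun v _ => ?_
  have : ∀ j v, ((g.toLinearMap ∘ₗ S ∘ₗ g.symm.toLinearMap) ^ j) (g v) = g ((S ^ j) v) := by
    intro j
    induction j with
    | zero => intro v; rfl
    | succ j ih =>
      intro v
      rw [pow_succ, Module.End.mul_apply, pow_succ, Module.End.mul_apply, ← ih]
      simp
  have h2 := this j v
  change _ = ψ (Q (((g.toLinearMap ∘ₗ S ∘ₗ g.symm.toLinearMap) ^ j) (g v)))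
  rw [h2, hg]

theorem count {F K V V' : Type*} [Field F] [Finite F] [CharP F 2] [Field K] [CharP K 2] [Algebra F K]
    [AddCommGroup V] [Module F V] [FiniteDimensional F V]
    [AddCommGroup V'] [Module K V'] [FiniteDimensional K V']
    (hsq : ∀ a : F, ∃ b, b ^ 2 = a) (hsqK : ∀ a : K, ∃ b, b ^ 2 = a)
    (hwp : ∀ a : K, ∃ c, a = c ^ 2 + c)
    {Q : QuadraticForm F V} {Q' : QuadraticForm K V'} {T : Module.End F V} {T' : Module.End K V'}
    {r : V} (O : OS Q T r) (hO : ∀ S, Q.mem_oLie S → IsNilpotent S → OS Q S r)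
    {σ : V →ₛₗ[algebraMap F K] V'} (hQ : ∀ v : V, Q' (σ v) = algebraMap F K (Q v))
    (hT : ∀ v, σ (T v) = T' (σ v)) {n : ℕ} (bs : Basis (Fin n) F V)
    (hli : LinearIndependent K (fun i => σ (bs i)))
    (hsp : Submodule.span K (Set.range fun i => σ (bs i)) = ⊤)
    {m : ℕ} {lam : Fin m → ℕ} {x₀ : Fin m × Bool → OS.Wq F r} (R : O.fs.Fr lam x₀) (ha : Antitone lam) :
    Nat.card (Quot fun x y :
        {S : Module.End F V // Q.mem_oLie S ∧ IsNilpotent S ∧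
          QuadraticForm.IsScalarExtension Q S Q' T'} =>
      Q.OConj x.1 y.1) = 2 ^ Nat.card {b // FS.Bk lam (fun i => O.fs.h (lam i)) b} := by
  classical
  have : Finite V := Module.finite_of_finite F
  have : Fintype V := Fintype.ofFinite V
  have E : SE Q Q' σ := SE.of_basis hQ bs hli hsp
  have O' : OS Q' T' (σ r) := E.os O hT
  obtain ⟨ψ, θ, ψ0, ψadd, ψsq, ψθ, ψpm, ψwp⟩ := exists_psi F
  obtain ⟨t, ht⟩ := hsq θ
  set h : Fin m → ℕ := fun i => O.fs.h (lam i) with hh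
  have hnum : FS.Num lam h := R.num ha
  obtain ⟨x, dl, N, hdl⟩ := R.exists_NF hsq ha
  let η : ({b // FS.Bk lam h b} → Bool) → Fin m → F := fun s b =>
    if hb : FS.Bk lam h b then (if s ⟨b, hb⟩ then t else 0) else 0
  have η0 : ∀ s b, ¬ FS.Bk lam h b → η s b = 0 := fun s b hb => by simp only [η]; rw [dif_neg hb]
  have η1 : ∀ s (b : {b // FS.Bk lam h b}), η s b.1 = if s b then t else 0 := fun s b => by
    simp only [η]; rw [dif_pos b.2]
  let u : Fin m → V := fun b => (T ^ (h b + 1)) (OS.sec F r (x (b, true)))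
  let St : ({b // FS.Bk lam h b} → Bool) → Module.End F V := fun s => twist Q T r (η s) u
  have Os : ∀ s, OS Q (St s) r := fun s => O.twist (η s) u
  have Sh : ∀ s, FS.Shift O.fs (Os s).fs h x (fun b => η s b ^ 2) := fun s =>
    O.twist_shift (η s) h (fun b => OS.sec F r (x (b, true))) x (fun b => (OS.mk_sec _ _ _).symm)
  have Ns : ∀ s, FS.NF (Os s).fs lam h x (fun i => dl i + η s i ^ 2) := fun s =>
    N.shift (Sh s) (fun i hi => by rw [η0 s i (fun hb => hb.2 hi)]; simp)
  -- membership in the class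
  have hcls : ∀ s, QuadraticForm.IsScalarExtension Q (St s) Q' T' := by
    intro s
    let T1 : Module.End K V' := twist Q' T' (σ r) (fun b => algebraMap F K (η s b)) (fun b => σ (u b))
    have hT1 : ∀ v, σ (St s v) = T1 (σ v) := by
      intro v
      simp only [St, T1]
      rw [twist_apply, twist_apply, map_add, LinearMap.map_smulₛₗ, hT, map_sum]
      congr 2
      refine Finset.sum_congr rfl fun b _ => ?_
      rw [map_mul, E.polar]
    have O1 : OS Q' T1 (σ r) := E.os (Os s) hT1
    have N1 := E.nf (Os s) hT1 O1 (Ns s)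
    have N2 := E.nf O hT O' N
    obtain ⟨y, N3⟩ := N1.adj hnum.le (fun i => algebraMap F K (dl i)) (fun i => by
      by_cases hb : FS.Bk lam h i
      · right
        refine ⟨by have := hb.1; omega, hb.2, ?_⟩
        obtain ⟨c, hc⟩ := hwp (algebraMap F K (η s i ^ 2))
        refine ⟨c, ?_⟩
        rw [← hc, map_add]
        linear_combination -FS.add_self_F (algebraMap F K (η s i ^ 2))
      · left
        rw [η0 s i hb]; simp)
    obtain ⟨g, hg1, hg2, hg3⟩ := N3.iso N2
    obtain ⟨G, hG1, hG2⟩ := O1.lift hsqK O' g hg1 hg2 hg3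
    refine ⟨G.toLinearMap.comp σ, fun v => ?_, fun v => ?_, n, bs, ?_, ?_⟩
    · simp only [LinearMap.comp_apply, LinearEquiv.coe_coe]
      rw [hG1, hQ]
    · simp only [LinearMap.comp_apply, LinearEquiv.coe_coe]
      rw [hT1, hG2]
    · exact hli.map' G.toLinearMap G.ker
    · have h1 : (Set.range fun i => (G.toLinearMap.comp σ) (bs i)) =
          G.toLinearMap '' (Set.range fun i => σ (bs i)) := by
        rw [← Set.range_comp]; rfl
      rw [h1, Submodule.span_image, hsp, Submodule.map_top, LinearEquiv.range]
  let Φ : ({b // FS.Bk lam h b} → Bool) → Quot fun x y :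
        {S : Module.End F V // Q.mem_oLie S ∧ IsNilpotent S ∧
          QuadraticForm.IsScalarExtension Q S Q' T'} => Q.OConj x.1 y.1 := fun s =>
    Quot.mk _ ⟨St s, (Os s).mem_oLie, (Os s).nil, hcls s⟩
  have hinj : Function.Injective Φ := by
    intro s s' hss
    by_contra hne
    have hI : ∀ j, ∑ v, ψ (Q ((St s ^ j) v)) = ∑ v, ψ (Q ((St s' ^ j) v)) := fun j =>
      congrArg (Quot.lift (fun z => ∑ v, ψ (Q ((z.1 ^ j) v))) (fun a b hab => OConj_sum hab ψ j)) hss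
    have hep : ∀ b : {b // FS.Bk lam h b}, s b ≠ s' b → η s b.1 ^ 2 + η s' b.1 ^ 2 = θ := by
      intro b hb
      rw [η1, η1]
      cases h1 : s b <;> cases h2 : s' b <;> simp_all
    have hep0 : ∀ b : {b // FS.Bk lam h b}, s b = s' b → η s b.1 ^ 2 + η s' b.1 ^ 2 = 0 := by
      intro b hb
      rw [η1, η1, hb]; exact FS.add_self_F _
    have hθ0 : θ ≠ 0 := by rintro rfl; rw [ψ0] at ψθ; norm_num at ψθ
    obtain ⟨b0, hb0⟩ := Function.ne_iff.1 hne
    have hmin : ∃ b, η s b ^ 2 + η s' b ^ 2 ≠ 0 ∧ ∀ i < b, ¬ (η s i ^ 2 + η s' i ^ 2 ≠ 0) := by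
      obtain ⟨b, hb, hb'⟩ := WellFounded.has_min (r := ((· < ·) : Fin m → Fin m → Prop)) wellFounded_lt
        {b | η s b ^ 2 + η s' b ^ 2 ≠ 0} ⟨b0.1, by
          change _ ≠ _
          rw [hep b0 hb0]; exact hθ0⟩
      exact ⟨b, hb, fun i hi h2 => hb' i h2 hi⟩
    obtain ⟨b, hb, hbm⟩ := hmin
    have hB : FS.Bk lam h b := by
      by_contra hB
      apply hb
      rw [η0 s b hB, η0 s' b hB]; simp
    have hsb : s ⟨b, hB⟩ ≠ s' ⟨b, hB⟩ := fun h1 => hb (hep0 ⟨b, hB⟩ h1)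
    obtain ⟨j, hj⟩ := (Ns s).sep hnum ((Sh s).trans (Sh s'))
      (fun i hi => by rw [η0 s i hi, η0 s' i hi]; simp) b hB
      (fun i hi => not_not.1 (hbm i hi)) ψ ψ0 ψadd ψsq
      (by rw [hep ⟨b, hB⟩ hsb, ψθ]; norm_num) hsq (OS.mq F r) (Submodule.mkQ_surjective _)
    apply hj
    simp only [OS.ka_Tp_mk]
    exact (hI (j + 1)).symm
  have hsurj : Function.Surjective Φ := by
    intro z
    obtain ⟨⟨S, hS1, hS2, σ', hQ', hT', n', bs', hli', hsp'⟩, rfl⟩ := Quot.exists_rep z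
    have E2 : SE Q Q' σ' := SE.of_basis hQ' bs' hli' hsp'
    have OS2 : OS Q S r := hO S hS1 hS2
    have O2 : OS Q' T' (σ' r) := E2.os OS2 hT'
    have hr : σ' r = σ r := by
      obtain ⟨c, hc⟩ := O'.nd (σ' r) O2.rad
      have h1 := O2.Qr
      rw [hc, OS.Q_smul, O'.Qr, mul_one] at h1
      have h2 : (c + 1) ^ 2 = 0 := by
        rw [CharTwo.add_sq, h1, one_pow]; exact FS.add_self_F 1
      have h3 : c = 1 := FS.eq_of_add_F (eq_zero_of_pow_eq_zero h2)
      rw [hc, h3, one_smul]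
    have tr : ∀ r1, r1 = σ r → ∀ O1 : OS Q' T' r1, (∀ k, finrank K (LinearMap.ker (O1.fs.T ^ k)) =
        finrank K (LinearMap.ker (O'.fs.T ^ k))) ∧ ∀ k, O1.fs.h k = O'.fs.h k := by
      rintro _ rfl O1
      exact ⟨fun _ => rfl, fun _ => rfl⟩
    obtain ⟨tr1, tr2⟩ := tr _ hr O2
    obtain ⟨m2, lam2, x2, R2, ha2⟩ := OS2.fs.exists_frame
    obtain ⟨e, he⟩ := lam_unique ha ha2 R.pos R2.pos (fun k => by
      rw [← (E.frame O hT O' R).finrank_ker, ← (E2.frame OS2 hT' O2 R2).finrank_ker, tr1])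
    subst e
    have hlam : lam2 = lam := by
      funext i; rw [he i]; rfl
    subst hlam
    have hheq : (fun i => OS2.fs.h (lam2 i)) = h := by
      funext i
      rw [E2.h_eq OS2 hT' O2, tr2, ← E.h_eq O hT O']
    obtain ⟨y, dl2, N2, hdl2⟩ := R2.exists_NF hsq ha2
    rw [hheq] at N2 hdl2
    let s : {b // FS.Bk lam2 h b} → Bool := fun b => decide (ψ (dl b.1 + dl2 b.1) = -1)
    refine ⟨s, ?_⟩
    apply Quot.sound
    obtain ⟨y', N3⟩ := N2.adj hnum.le (fun i => dl i + η s i ^ 2) (fun i => by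
      by_cases hb : FS.Bk lam2 h i
      · right
        refine ⟨by have := hb.1; omega, hb.2, ?_⟩
        obtain ⟨c, hc⟩ := ψwp (dl i + dl2 i + η s i ^ 2) (by
          rw [ψadd]
          have h1 := η1 s ⟨i, hb⟩
          simp only at h1
          rw [h1]
          simp only [s]
          rcases ψpm (dl i + dl2 i) with h2 | h2
          · simp [h2, ψ0]
          · simp [h2, ht, ψθ])
        refine ⟨c, ?_⟩
        rw [← hc]
        linear_combination -FS.add_self_F (dl2 i)
      · left
        rw [η0 s i hb, hdl i hb, hdl2 i hb]; simp)
    obtain ⟨g, hg1, hg2, hg3⟩ := (Ns s).iso N3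
    exact (Os s).oconj hsq OS2 g hg1 hg2 hg3
  rw [← Nat.card_eq_of_bijective Φ ⟨hinj, hsurj⟩, Nat.card_fun]
  simp

theorem comb_card {r k m : ℕ} {lam chi : ℕ → ℕ} {lamW : Fin r → ℕ} {h χ : ℕ → ℕ}
    (hdec : ∀ i, i + 1 < k → lam (i + 1) < lam i) (hpos : ∀ i < k, 1 ≤ lam i)
    (hposW : ∀ b, 1 ≤ lamW b) (anti : Antitone lamW) (hmono : Monotone h)
    (hle : ∀ b, lamW b ≤ 2 * h (lamW b) + 2) (χ1 : ∀ j ≤ m + 1, χ j = j)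
    (χ2 : ∀ j, m < j → χ j = h j + 1) (h1 : ∀ j ≤ m, h j = j)
    (hD : ∀ j, 1 ≤ j → ((∃ i < k, lam i = j) ↔ (∃ b, lamW b = j) ∨ j = m + 1))
    (hm : 1 ≤ m → ∃ b, lamW b = m) (hchi : ∀ i < k, chi i = χ (lam i)) :
    Nat.card {b // FS.Bk lamW (fun i => h (lamW i)) b} = symbolN1 k lam chi := by
  classical
  have χmono : Monotone χ := by
    intro a b hab
    by_cases ha : a ≤ m
    · by_cases hb : b ≤ m
      · rw [χ1 a (by omega), χ1 b (by omega)]; exact hab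
      · rw [χ1 a (by omega), χ2 b (by omega)]
        have := hmono hab
        rw [h1 a ha] at this
        omega
    · rw [χ2 a (by omega), χ2 b (by omega)]
      have := hmono hab
      omega
  have hdec' : ∀ i j, i < j → j < k → lam j < lam i := by
    intro i j hij
    induction j, hij using Nat.le_induction with
    | base => intro hk; exact hdec i hk
    | succ j hj ih => intro hk; exact (hdec j hk).trans (ih (by omega))
  have hM1 : ∃ i < k, lam i = m + 1 := (hD (m + 1) (by omega)).2 (Or.inr rfl)
  have h0 : h 0 = 0 := h1 0 (by omega)
  let PV : ℕ → Prop := fun v => (∃ i < k, lam i = v) ∧ (∃ i < k, lam i < v) ∧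
    (∀ i < k, lam i < v → χ v + χ (lam i) ≤ v) ∧ 2 * χ v ≠ v
  let PW : ℕ → Prop := fun v => (∃ b, lamW b = v) ∧ h v + 2 ≤ v ∧
    (∀ b, lamW b < v → h v + h (lamW b) + 2 ≤ v) ∧ v ≠ 2 * h v + 2
  have hPP : ∀ v, PV v ↔ PW v := by
    intro v
    constructor
    · rintro ⟨⟨i, hi, hiv⟩, ⟨j, hj, hjv⟩, hall, hne⟩
      have hv : m + 1 < v := by
        by_contra hcon
        have e1 := hall j hj hjv
        have := hpos j hj
        rw [χ1 v (by omega), χ1 (lam j) (by omega)] at e1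
        omega
      rw [χ2 v (by omega)] at hall hne
      obtain ⟨i1, hi1, hi1'⟩ := hM1
      have e2 := hall i1 hi1 (by omega)
      rw [hi1', χ1 _ le_rfl] at e2
      have hvW : ∃ b, lamW b = v := by
        rcases (hD v (by omega)).1 ⟨i, hi, hiv⟩ with h | h
        · exact h
        · omega
      refine ⟨hvW, by omega, ?_, by omega⟩
      intro b hb
      by_cases hbm : lamW b ≤ m
      · rw [h1 _ hbm]; omega
      · obtain ⟨i2, hi2, hi2'⟩ := (hD _ (hposW b)).2 (Or.inl ⟨b, rfl⟩)
        have e3 := hall i2 hi2 (by omega)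
        rw [hi2', χ2 _ (by omega)] at e3
        omega
    · rintro ⟨⟨b, hb⟩, hle2, hall, hne⟩
      have hv : m + 1 < v := by
        by_contra hcon
        by_cases hvm : v ≤ m
        · have := h1 v hvm; omega
        · have e1 := hmono (show m ≤ v by omega)
          rw [h1 m le_rfl] at e1
          omega
      have hm2 : h v + m + 2 ≤ v := by
        by_cases hm0 : m = 0
        · omega
        · obtain ⟨b1, hb1⟩ := hm (by omega)
          have := hall b1 (by omega)
          rw [hb1, h1 m le_rfl] at this
          omega
      obtain ⟨i1, hi1, hi1'⟩ := hM1
      refine ⟨(hD v (by omega)).2 (Or.inl ⟨b, hb⟩), ⟨i1, hi1, by omega⟩, ?_, ?_⟩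
      · intro i hi hiv
        rw [χ2 v (by omega)]
        by_cases him : lam i ≤ m + 1
        · rw [χ1 _ him]; omega
        · rcases (hD _ (hpos i hi)).1 ⟨i, hi, rfl⟩ with h | h
          · obtain ⟨b2, hb2⟩ := h
            have := hall b2 (by omega)
            rw [χ2 _ (by omega), ← hb2]
            omega
          · omega
      · rw [χ2 v (by omega)]; omega
  set Bs : Finset (Fin r) := {b | FS.Bk lamW (fun i => h (lamW i)) b} with hBs
  set As : Finset ℕ := (Finset.range k).filter fun i =>
    i + 1 < k ∧ chi i + chi (i + 1) ≤ lam i ∧ 2 * chi i ≠ lam i with hAs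
  have hA : ∀ v, v ∈ As.image lam ↔ PV v := by
    intro v
    simp only [Finset.mem_image, hAs, Finset.mem_filter, Finset.mem_range]
    constructor
    · rintro ⟨i, ⟨hi, hi1, hc, hne⟩, rfl⟩
      rw [hchi i hi] at hc hne
      rw [hchi (i + 1) hi1] at hc
      refine ⟨⟨i, hi, rfl⟩, ⟨i + 1, hi1, hdec i hi1⟩, ?_, hne⟩
      intro j hj hlt
      have hij : i < j := by
        by_contra hcon
        rcases Nat.lt_or_ge j i with h | h
        · have := hdec' j i h hi; omega
        · have : j = i := by omega
          subst this; omega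
      have : lam j ≤ lam (i + 1) := by
        rcases Nat.lt_or_ge (i + 1) j with h | h
        · exact (hdec' _ _ h hj).le
        · have : j = i + 1 := by omega
          subst this; exact le_rfl
      have := χmono this
      omega
    · rintro ⟨⟨i, hi, rfl⟩, ⟨j, hj, hlt⟩, hall, hne⟩
      have hij : i < j := by
        by_contra hcon
        rcases Nat.lt_or_ge j i with h | h
        · have := hdec' j i h hi; omega
        · have : j = i := by omega
          subst this; omega
      have hi1 : i + 1 < k := by omega
      refine ⟨i, ⟨hi, hi1, ?_, ?_⟩, rfl⟩
      · rw [hchi i hi, hchi _ hi1]; exact hall (i + 1) hi1 (hdec i hi1)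
      · rw [hchi i hi]; exact hne
  have hlast : ∀ b b', FS.Bk lamW (fun i => h (lamW i)) b → b < b' → lamW b' < lamW b := by
    intro b b' hb hbb
    by_contra hcon
    have e1 : lamW b' = lamW b := le_antisymm (anti hbb.le) (not_lt.1 hcon)
    have hlt : (b : ℕ) < b' := hbb
    have hb1 : (b : ℕ) + 1 < r := by have := b'.2; omega
    have e2 := hb.1
    have e3 := hb.2
    rw [FS.hn, dif_pos hb1] at e2
    have e4 : lamW b' ≤ lamW ⟨b + 1, hb1⟩ := anti (by rw [Fin.le_def]; simp only; omega)
    have e5 := hmono e4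
    have e6 := hle b
    rw [e1] at e5
    simp only at e2 e3
    omega
  have hB : ∀ v, v ∈ Bs.image lamW ↔ PW v := by
    intro v
    simp only [Finset.mem_image, hBs, Finset.mem_filter, Finset.mem_univ, true_and]
    constructor
    · rintro ⟨b, hb, rfl⟩
      have e2 := hb.1
      have e3 := hb.2
      simp only at e2 e3
      refine ⟨⟨b, rfl⟩, by omega, ?_, e3⟩
      intro b' hlt
      have hbb : (b : ℕ) < b' := by
        by_contra hcon
        have := anti (show b' ≤ b by rw [Fin.le_def]; omega)
        omega
      have hb1 : (b : ℕ) + 1 < r := by have := b'.2; omega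
      rw [FS.hn, dif_pos hb1] at e2
      have e4 : lamW b' ≤ lamW ⟨b + 1, hb1⟩ := anti (by rw [Fin.le_def]; simp only; omega)
      have := hmono e4
      omega
    · rintro ⟨⟨b0, hb0⟩, hle2, hall, hne⟩
      have hne0 : ({b | lamW b = v} : Finset (Fin r)).Nonempty := ⟨b0, by simp [hb0]⟩
      obtain ⟨b, hb, hbmax⟩ := Finset.exists_max_image _ (fun b => b) hne0
      simp only [Finset.mem_filter, Finset.mem_univ, true_and] at hb hbmax
      refine ⟨b, ⟨?_, ?_⟩, hb⟩
      · rw [FS.hn]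
        split_ifs with hb1
        · simp only [hb]
          have hlt : lamW ⟨b + 1, hb1⟩ < v := by
            rcases lt_or_eq_of_le (anti (show b ≤ ⟨b + 1, hb1⟩ by rw [Fin.le_def]; simp)) with h | h
            · omega
            · have := hbmax ⟨b + 1, hb1⟩ (h.trans hb)
              rw [Fin.le_def] at this
              simp at this
          have := hall _ hlt
          omega
        · simp only [hb]; omega
      · simp only [hb]; exact hne
  have hcA : (As.image lam).card = As.card := by
    apply Finset.card_image_of_injOn
    intro i hi j hj hij
    simp only [hAs, Finset.coe_filter, Finset.mem_range, Set.mem_ofPred_eq] at hi hj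
    rcases Nat.lt_trichotomy i j with h | h | h
    · have := hdec' i j h hj.1; omega
    · exact h
    · have := hdec' j i h hi.1; omega
  have hcB : (Bs.image lamW).card = Bs.card := by
    apply Finset.card_image_of_injOn
    intro i hi j hj hij
    simp only [hBs, Finset.coe_filter, Finset.mem_univ, true_and, Set.mem_ofPred_eq] at hi hj
    rcases lt_trichotomy i j with h | h | h
    · have := hlast i j hi h; omega
    · exact h
    · have := hlast j i hj h; omega
  have himg : As.image lam = Bs.image lamW := by
    ext v; rw [hA, hB, hPP]
  rw [Nat.card_eq_fintype_card, Fintype.card_subtype, symbolN1, ← hAs, ← hcA, himg, hcB]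

theorem comb_mult {r k m : ℕ} {lam mult : ℕ → ℕ} {lamW : Fin r → ℕ}
    (hmul : ∀ i < k, 1 ≤ mult i)
    (hs : ∀ j, ∑ i ∈ range k, mult i * min j (lam i) =
      (∑ b, 2 * min j (lamW b)) + if m < j then 1 else 0) :
    (∀ j, 1 ≤ j → ((∃ i < k, lam i = j) ↔ (∃ b, lamW b = j) ∨ j = m + 1)) ∧
      (1 ≤ m → ∃ b, lamW b = m) := by
  classical
  have key : ∀ j, 1 ≤ j → (∑ i ∈ range k, if lam i = j then mult i else 0) + (if j = m then 1 else 0) =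
      (∑ b, if lamW b = j then 2 else 0) + if j = m + 1 then 1 else 0 := by
    intro j hj
    obtain ⟨j, rfl⟩ : ∃ j', j = j' + 1 := ⟨j - 1, by omega⟩
    have e0 := hs j
    have e1 := hs (j + 1)
    have e2 := hs (j + 2)
    have f1 : (∑ i ∈ range k, mult i * min j (lam i)) + (∑ i ∈ range k, mult i * min (j + 2) (lam i)) +
        (∑ i ∈ range k, if lam i = j + 1 then mult i else 0) =
        (∑ i ∈ range k, mult i * min (j + 1) (lam i)) + ∑ i ∈ range k, mult i * min (j + 1) (lam i) := by
      rw [← Finset.sum_add_distrib, ← Finset.sum_add_distrib, ← Finset.sum_add_distrib]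
      refine Finset.sum_congr rfl fun i _ => ?_
      have hc : min j (lam i) + min (j + 2) (lam i) + (if lam i = j + 1 then 1 else 0) =
        min (j + 1) (lam i) + min (j + 1) (lam i) := by split_ifs <;> omega
      rw [← mul_add, ← mul_add, ← hc]
      split_ifs <;> ring
    have f2 : (∑ b, 2 * min j (lamW b)) + (∑ b, 2 * min (j + 2) (lamW b)) +
        (∑ b, if lamW b = j + 1 then 2 else 0) =
        (∑ b, 2 * min (j + 1) (lamW b)) + ∑ b, 2 * min (j + 1) (lamW b) := by
      rw [← Finset.sum_add_distrib, ← Finset.sum_add_distrib, ← Finset.sum_add_distrib]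
      refine Finset.sum_congr rfl fun i _ => ?_
      split_ifs <;> omega
    split_ifs at e0 e1 e2 ⊢ <;> omega
  have hV : ∀ j, (∃ i < k, lam i = j) ↔ 0 < ∑ i ∈ range k, if lam i = j then mult i else 0 := by
    intro j
    rw [Finset.sum_pos_iff]
    constructor
    · rintro ⟨i, hi, rfl⟩
      exact ⟨i, Finset.mem_range.2 hi, by rw [if_pos rfl]; exact hmul i hi⟩
    · rintro ⟨i, hi, h⟩
      refine ⟨i, Finset.mem_range.1 hi, ?_⟩
      by_contra hne
      rw [if_neg hne] at h
      omega
  have hW : ∀ j, (∃ b, lamW b = j) ↔ 0 < ∑ b, if lamW b = j then 2 else 0 := by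
    intro j
    rw [Finset.sum_pos_iff]
    constructor
    · rintro ⟨i, rfl⟩
      exact ⟨i, Finset.mem_univ _, by rw [if_pos rfl]; norm_num⟩
    · rintro ⟨i, hi, h⟩
      refine ⟨i, ?_⟩
      by_contra hne
      rw [if_neg hne] at h
      omega
  have heven : ∀ j, ∃ c, (∑ b, if lamW b = j then 2 else 0) = 2 * c := by
    intro j
    refine ⟨∑ b, if lamW b = j then 1 else 0, ?_⟩
    rw [Finset.mul_sum]
    refine Finset.sum_congr rfl fun i _ => ?_
    split_ifs <;> rfl
  constructor
  · intro j hj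
    rw [hV, hW]
    have h1 := key j hj
    obtain ⟨c, hc⟩ := heven j
    rw [hc] at h1 ⊢
    split_ifs at h1 <;> omega
  · intro hm
    rw [hW]
    have h1 := key m hm
    rw [if_pos rfl, if_neg (by omega)] at h1
    omega

namespace OS

variable {F V : Type*} [Field F] [CharP F 2] [AddCommGroup V] [Module F V] {Q : QuadraticForm F V}
variable {T : Module.End F V} {r : V} (O : OS Q T r)
include O

theorem r_ne : r ≠ 0 := by
  rintro rfl
  have := O.Qr
  rw [QuadraticMap.map_zero] at this
  exact zero_ne_one this

theorem exists_depth : ∃ m, ∀ j, (∃ u, (T ^ j) u = r) ↔ j ≤ m := by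
  classical
  have hex : ∃ j, ¬ ∃ u, (T ^ j) u = r := by
    obtain ⟨n, hn⟩ := O.nil
    refine ⟨n, ?_⟩
    rintro ⟨u, hu⟩
    rw [hn, LinearMap.zero_apply] at hu
    exact O.r_ne hu.symm
  have hmon : ∀ i j, i ≤ j → (∃ u, (T ^ j) u = r) → ∃ u, (T ^ i) u = r := by
    rintro i j hij ⟨u, hu⟩
    refine ⟨(T ^ (j - i)) u, ?_⟩
    rw [FS.pw, show i + (j - i) = j by omega, hu]
  have h0 : Nat.find hex ≠ 0 := by
    intro h
    have := Nat.find_spec hex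
    rw [h] at this
    exact this ⟨r, by simp⟩
  refine ⟨Nat.find hex - 1, fun j => ⟨fun hj => ?_, fun hj => ?_⟩⟩
  · by_contra hcon
    exact Nat.find_spec hex (hmon _ j (by omega) hj)
  · have := Nat.find_min hex (m := j) (by omega)
    exact not_not.1 this

variable {m : ℕ} (hm : ∀ j, (∃ u, (T ^ j) u = r) ↔ j ≤ m)
include hm

theorem chi_low {j : ℕ} (hj : j ≤ m + 1) : Q.indexChi T j = j := by
  obtain ⟨u, hu⟩ := (hm m).2 le_rfl
  have hmem : j ∈ {i : ℕ | ∀ v : V, (T ^ j) v = 0 → Q ((T ^ i) v) = 0} := by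
    intro v hv
    rw [hv, QuadraticMap.map_zero]
  apply le_antisymm
  · exact Nat.sInf_le hmem
  · refine le_csInf ⟨j, hmem⟩ ?_
    intro i hi
    by_contra hcon
    have h1 : (T ^ i) ((T ^ (m - i)) u) = r := by
      rw [FS.pw, show i + (m - i) = m by omega, hu]
    have h2 := hi ((T ^ (m - i)) u) (by
      rw [show j = (j - i - 1) + 1 + i by omega, ← FS.pw, h1, ← FS.pw, pow_one, O.Tr, map_zero])
    rw [h1, O.Qr] at h2
    exact one_ne_zero h2

theorem h_low {j : ℕ} (hj : j ≤ m) : O.fs.h j = j := by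
  obtain ⟨u, hu⟩ := (hm m).2 le_rfl
  apply le_antisymm (O.fs.h_le_self j)
  by_contra hcon
  obtain ⟨i, rfl⟩ : ∃ i, j = i + 1 := ⟨j - 1, by omega⟩
  have h0 : O.fs.h (i + 1) ≤ i := by omega
  have h1 : (T ^ (i + 1)) ((T ^ (m - (i + 1))) u) = r := by
    rw [FS.pw, show i + 1 + (m - (i + 1)) = m by omega, hu]
  have h2 := O.fs.h_le_iff.1 h0 (mq F r ((T ^ (m - (i + 1))) u)) (by
    rw [O.Tp_mk, h1, ← map_zero (mq F r), mk_eq_iff]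
    exact ⟨1, by simp⟩)
  rw [O.ka_Tp_mk, h1, O.Qr] at h2
  exact one_ne_zero h2

theorem chi_high {j : ℕ} (hj : m < j) : Q.indexChi T j = O.fs.h j + 1 := by
  have hker : ∀ v, (O.fs.T ^ j) (mq F r v) = 0 → (T ^ j) v = 0 := by
    intro v hv
    rw [O.Tp_mk, ← map_zero (mq F r), mk_eq_iff] at hv
    obtain ⟨c, hc⟩ := hv
    rw [zero_add] at hc
    by_cases hc0 : c = 0
    · rw [hc, hc0, zero_smul]
    · exfalso
      have := (hm j).1 ⟨c⁻¹ • v, by rw [map_smul, hc, smul_smul, inv_mul_cancel₀ hc0, one_smul]⟩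
      omega
  have hmem : O.fs.h j + 1 ∈ {i : ℕ | ∀ v : V, (T ^ j) v = 0 → Q ((T ^ i) v) = 0} := by
    intro v hv
    rw [← O.ka_Tp_mk]
    apply O.fs.ka_eq_zero le_rfl
    rw [O.Tp_mk, hv, map_zero]
  apply le_antisymm
  · exact Nat.sInf_le hmem
  · refine le_csInf ⟨_, hmem⟩ ?_
    intro i hi
    by_contra hcon
    rcases Nat.eq_zero_or_pos i with h0 | h0
    · subst h0
      have h1 := hi r (by
        rw [show j = (j - 1) + 1 by omega, ← FS.pw, pow_one, O.Tr, map_zero])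
      rw [pow_zero, Module.End.one_apply, O.Qr] at h1
      exact one_ne_zero h1
    · obtain ⟨i, rfl⟩ : ∃ i', i = i' + 1 := ⟨i - 1, by omega⟩
      have : O.fs.h j ≤ i := by
        rw [O.fs.h_le_iff]
        intro w hw
        rw [← mk_sec F r w] at hw ⊢
        rw [O.ka_Tp_mk]
        exact hi _ (hker _ hw)
      omega

theorem finrank_ker [FiniteDimensional F V] (j : ℕ) : finrank F (LinearMap.ker (T ^ j)) =
    finrank F (LinearMap.ker (O.fs.T ^ j)) + if m < j then 1 else 0 := by
  have h1 := LinearMap.finrank_range_add_finrank_ker (T ^ j)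
  have h2 := LinearMap.finrank_range_add_finrank_ker (O.fs.T ^ j)
  have h3 := O.finrank_W
  set f := (mq F r).domRestrict (LinearMap.range (T ^ j)) with hf
  have h4 := LinearMap.finrank_range_add_finrank_ker f
  have h5 : LinearMap.range f = LinearMap.range (O.fs.T ^ j) := by
    ext w
    constructor
    · rintro ⟨⟨_, ⟨v, rfl⟩⟩, rfl⟩
      exact ⟨mq F r v, O.Tp_mk j v⟩
    · rintro ⟨w, rfl⟩
      refine ⟨⟨(T ^ j) (sec F r w), ⟨_, rfl⟩⟩, ?_⟩
      change mq F r ((T ^ j) (sec F r w)) = _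
      rw [← O.Tp_mk, mk_sec]
  have h6 : finrank F (LinearMap.ker f) = if m < j then 0 else 1 := by
    have hk : ∀ z : LinearMap.range (T ^ j), z ∈ LinearMap.ker f ↔ ∃ c : F, (z : V) = c • r := by
      intro z
      rw [LinearMap.mem_ker]
      change mq F r z = 0 ↔ _
      rw [← map_zero (mq F r), mk_eq_iff]
      simp
    split_ifs with hj
    · rw [finrank_eq_zero_iff_of_free]
      refine ⟨fun a b => ?_⟩
      have hz : ∀ a : LinearMap.ker f, a = 0 := by
        rintro ⟨⟨_, ⟨v, rfl⟩⟩, hv⟩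
        obtain ⟨c, hc⟩ := (hk _).1 hv
        simp only at hc
        apply Subtype.ext
        apply Subtype.ext
        change (T ^ j) v = 0
        by_cases hc0 : c = 0
        · rw [hc, hc0, zero_smul]
        · exfalso
          have := (hm j).1 ⟨c⁻¹ • v, by rw [map_smul, hc, smul_smul, inv_mul_cancel₀ hc0, one_smul]⟩
          omega
      rw [hz a, hz b]
    · obtain ⟨u, hu⟩ := (hm j).2 (by omega)
      have hr : (⟨r, ⟨u, hu⟩⟩ : LinearMap.range (T ^ j)) ∈ LinearMap.ker f :=
        (hk _).2 ⟨1, by simp⟩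
      rw [finrank_eq_one_iff']
      refine ⟨⟨_, hr⟩, ?_, ?_⟩
      · intro h0
        have := congrArg (fun z : LinearMap.ker f => ((z : LinearMap.range (T ^ j)) : V)) h0
        exact O.r_ne this
      · rintro ⟨z, hz⟩
        obtain ⟨c, hc⟩ := (hk _).1 hz
        refine ⟨c, ?_⟩
        apply Subtype.ext
        apply Subtype.ext
        exact hc.symm
  rw [h5] at h4
  split_ifs at h6 ⊢ <;> omega

end OS

theorem OS.symbol_card {F V : Type*} [Field F] [CharP F 2] [AddCommGroup V] [Module F V]
    {Q : QuadraticForm F V} {T : Module.End F V} {r : V} (O : OS Q T r)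
    [FiniteDimensional F V] {k : ℕ} {lam mult chi : ℕ → ℕ}
    (hs : Q.IsSymbolOf T k lam mult chi) {s : ℕ} {lamW : Fin s → ℕ} {x : Fin s × Bool → OS.Wq F r}
    (R : O.fs.Fr lamW x) (ha : Antitone lamW) :
    Nat.card {b // FS.Bk lamW (fun i => O.fs.h (lamW i)) b} = symbolN1 k lam chi := by
  obtain ⟨hdec, hpos, hmul, hker, hchi⟩ := hs
  obtain ⟨m, hm⟩ := O.exists_depth
  obtain ⟨hD, hD2⟩ := comb_mult (m := m) (lamW := lamW) hmul (fun j => by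
    rw [← hker, O.finrank_ker hm, R.finrank_ker])
  exact comb_card (χ := fun j => Q.indexChi T j) (m := m) hdec hpos R.pos ha
    (fun _ _ h => O.fs.h_mono h) R.lam_le (fun j hj => O.chi_low hm hj) (fun j hj => O.chi_high hm hj)
    (fun j hj => O.h_low hm hj) hD hD2 hchi

/-- Let `F` be a finite field of characteristic 2, `V` a non-degenerate quadratic space of
dimension `2n + 1` over `F`, and `T` a nilpotent element of `𝔬(V)`.  If the scalar extension
of `(V, T)` to the algebraic closure of `F` has symbol `(λ_i, χ_i, m_i)_{1 ≤ i ≤ k}`, then the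
set of nilpotent `T' ∈ 𝔬(V)` whose scalar extension is isomorphic to that of `(V, T)` is the
union of exactly `2^{n₁}` orbits of `O(V)` acting by conjugation. -/
theorem card_orbits_in_geometric_class_odd_orthogonal
    (F : Type*) [Field F] [Fintype F] [CharP F 2]
    (n : ℕ) (hn : 1 ≤ n)
    (V : Type*) [AddCommGroup V] [Module F V] [FiniteDimensional F V]
    (Q : QuadraticForm F V)
    (hdim : Module.finrank F V = 2 * n + 1)
    (hQ : Q.IsNondegenerateFormSpace)
    (T : Module.End F V) (hT : Q.mem_oLie T) (hTnil : IsNilpotent T)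
    (V' : Type*) [AddCommGroup V'] [Module (AlgebraicClosure F) V']
    [FiniteDimensional (AlgebraicClosure F) V']
    (Q' : QuadraticForm (AlgebraicClosure F) V') (T' : Module.End (AlgebraicClosure F) V')
    (hext : QuadraticForm.IsScalarExtension Q T Q' T')
    (k : ℕ) (lam mult chi : ℕ → ℕ) (hsymb : Q'.IsSymbolOf T' k lam mult chi) :
    Nat.card (Quot fun x y :
        {S : Module.End F V // Q.mem_oLie S ∧ IsNilpotent S ∧
          QuadraticForm.IsScalarExtension Q S Q' T'} =>
      Q.OConj x.1 y.1) = 2 ^ symbolN1 k lam chi := by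
  have : CharP (AlgebraicClosure F) 2 :=
    charP_of_injective_algebraMap (algebraMap F (AlgebraicClosure F)).injective 2
  have hsq : ∀ a : F, ∃ b, b ^ 2 = a := by
    intro a
    obtain ⟨b, hb⟩ := FiniteField.isSquare_of_char_two (ringChar.eq F 2) a
    exact ⟨b, by rw [hb, pow_two]⟩
  have hsqK : ∀ a : AlgebraicClosure F, ∃ b, b ^ 2 = a := fun a =>
    IsAlgClosed.exists_pow_nat_eq a (by norm_num)
  have hwp : ∀ a : AlgebraicClosure F, ∃ c, a = c ^ 2 + c := by
    intro a
    open Polynomial in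
    obtain ⟨c, hc⟩ := IsAlgClosed.exists_root (X ^ 2 + X + C a : (AlgebraicClosure F)[X]) (by
      have : (X ^ 2 + X + C a : (AlgebraicClosure F)[X]) = C 1 * X ^ 2 + C 1 * X + C a := by simp
      rw [this, degree_quadratic one_ne_zero]
      norm_num)
    refine ⟨c, ?_⟩
    rw [Polynomial.IsRoot] at hc
    simp only [Polynomial.eval_add, Polynomial.eval_pow, Polynomial.eval_X, Polynomial.eval_C] at hc
    exact (FS.eq_of_add_F hc).symm
  obtain ⟨r, hr⟩ := OS.exists_of hsq Q hdim hQ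
  have O := hr T hT hTnil
  obtain ⟨σ, hσQ, hσT, d, bs, hli, hsp⟩ := hext
  have E : SE Q Q' σ := SE.of_basis hσQ bs hli hsp
  have O' : OS Q' T' (σ r) := E.os O hσT
  obtain ⟨m, lamW, x, R, ha⟩ := O.fs.exists_frame
  rw [count hsq hsqK hwp O hr hσQ hσT bs hli hsp R ha,
    ← O'.symbol_card hsymb (E.frame O hσT O' R) ha]
  congr 2
  simp only [E.h_eq O hσT O']
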